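/- For every C > 0 and ε > 0 there exists D₀ = D₀(C, ε) such that the following holds for every integer D ≥ D₀. Let G₁, …, G_m be graphs that (i) are nearly disjoint and (ii) satisfy |{i ∈ [m] : v ∈ V(G_i)}| ≤ C for every v ∈ ⋃_{i=1}^m V(G_i). If (L, M) is a correspondence assignment for G := ⋃_{i=1}^m G_i satisfying (iii) Δ(G_i, (L|_{V(G_i)}, M|_{E(G_i)})) ≤ D for every i ∈ [m] and (iv) |L(v)| ≥ (1 + ε)D for every v ∈ V(G), then G is (L, M)-colorable. -/

import Mathlib

open Finset

namespace NearlyDisjoint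

section Product

variable {V β : Type*} [Fintype V] [DecidableEq V] [Fintype β]

/-- `μ v` is a probability vector for every `v`. -/
structure IsProb (μ : V → β → ℝ) : Prop where
  nonneg : ∀ v x, 0 ≤ μ v x
  sum_eq : ∀ v, ∑ x, μ v x = 1

/-- Expectation under the product of the probability vectors `μ v`. -/
noncomputable def expect (μ : V → β → ℝ) (f : (V → β) → ℝ) : ℝ :=
  ∑ ω, (∏ v, μ v (ω v)) * f ω

open Classical in
/-- Probability under the product of the probability vectors `μ v`. -/
noncomputable def prob (μ : V → β → ℝ) (A : (V → β) → Prop) : ℝ :=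
  expect μ fun ω => if A ω then 1 else 0

variable {μ : V → β → ℝ}

lemma expect_add (f g : (V → β) → ℝ) :
    expect μ (fun ω => f ω + g ω) = expect μ f + expect μ g := by
  simp [expect, mul_add, sum_add_distrib]

lemma expect_const_mul (a : ℝ) (f : (V → β) → ℝ) :
    expect μ (fun ω => a * f ω) = a * expect μ f := by
  simp only [expect, mul_sum]
  exact sum_congr rfl fun _ _ => by ring

lemma expect_sum {κ : Type*} (s : Finset κ) (f : κ → (V → β) → ℝ) :
    expect μ (fun ω => ∑ k ∈ s, f k ω) = ∑ k ∈ s, expect μ (f k) := by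
  simp only [expect, mul_sum]
  exact sum_comm

lemma expect_prod (g : V → β → ℝ) :
    expect μ (fun ω => ∏ v, g v (ω v)) = ∏ v, ∑ x, μ v x * g v x := by
  simp only [expect, ← prod_mul_distrib]
  rw [Finset.prod_univ_sum, Fintype.piFinset_univ]

lemma expect_mono (hμ : IsProb μ) {f g : (V → β) → ℝ} (h : ∀ ω, f ω ≤ g ω) :
    expect μ f ≤ expect μ g :=
  sum_le_sum fun ω _ => mul_le_mul_of_nonneg_left (h ω) (prod_nonneg fun v _ => hμ.nonneg v _)

lemma expect_const (hμ : IsProb μ) (a : ℝ) : expect μ (fun _ => a) = a := by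
  have h := expect_prod (μ := μ) fun _ _ => 1
  simp only [prod_const_one, mul_one, hμ.sum_eq] at h
  simpa [h] using expect_const_mul (μ := μ) a fun _ => 1

lemma expect_nonneg (hμ : IsProb μ) {f : (V → β) → ℝ} (h : ∀ ω, 0 ≤ f ω) : 0 ≤ expect μ f := by
  simpa [expect_const hμ] using expect_mono hμ h

lemma prob_nonneg (hμ : IsProb μ) (A : (V → β) → Prop) : 0 ≤ prob μ A :=
  expect_nonneg hμ fun ω => by split_ifs <;> norm_num

lemma prob_mono (hμ : IsProb μ) {A B : (V → β) → Prop} (h : ∀ ω, A ω → B ω) :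
    prob μ A ≤ prob μ B :=
  expect_mono hμ fun ω => by
    by_cases hA : A ω
    · simp [hA, h ω hA]
    · simp only [hA, if_false]; split_ifs <;> norm_num

lemma prob_or_le (hμ : IsProb μ) (A B : (V → β) → Prop) :
    prob μ (fun ω => A ω ∨ B ω) ≤ prob μ A + prob μ B := by
  rw [prob, prob, prob, ← expect_add]
  refine expect_mono hμ fun ω => ?_
  by_cases hA : A ω <;> by_cases hB : B ω <;> simp [hA, hB]

lemma prob_exists_le (hμ : IsProb μ) {κ : Type*} (s : Finset κ) (A : κ → (V → β) → Prop) :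
    prob μ (fun ω => ∃ k ∈ s, A k ω) ≤ ∑ k ∈ s, prob μ (A k) := by
  classical
  simp only [prob]
  rw [← expect_sum]
  refine expect_mono hμ fun ω => ?_
  split_ifs with h
  · obtain ⟨k, hk, hA⟩ := h
    refine le_trans ?_ (single_le_sum (f := fun k => if A k ω then (1 : ℝ) else 0)
      (fun _ _ => by positivity) hk)
    simp [hA]
  · exact sum_nonneg fun _ _ => by positivity

lemma expect_update (hμ : IsProb μ) (v : V) (f : (V → β) → ℝ) :
    expect μ f = expect μ fun ω => ∑ x, μ v x * f (Function.update ω v x) := by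
  have hw : ∀ (ω : V → β) x, (∏ u, μ u (ω u)) * μ v x =
      (∏ u, μ u (Function.update ω v x u)) * μ v (ω v) := by
    intro ω x
    rw [← mul_prod_erase univ _ (mem_univ v), ← mul_prod_erase univ (fun u => μ u
      (Function.update ω v x u)) (mem_univ v)]
    have : ∏ u ∈ univ.erase v, μ u (Function.update ω v x u) = ∏ u ∈ univ.erase v, μ u (ω u) :=
      prod_congr rfl fun u hu => by rw [Function.update_of_ne (ne_of_mem_erase hu)]
    rw [this, Function.update_self]
    ring
  simp only [expect, mul_sum]
  rw [← Fintype.sum_prod_type' fun ω x =>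
    (∏ u, μ u (ω u)) * (μ v x * f (Function.update ω v x))]
  have inv : Function.Involutive
      fun z : (V → β) × β => (Function.update z.1 v z.2, z.1 v) := by
    rintro ⟨ω, x⟩
    simp
  rw [← Equiv.sum_comp inv.toPerm, Fintype.sum_prod_type]
  refine sum_congr rfl fun ω _ => ?_
  rw [← mul_one ((∏ u, μ u (ω u)) * f ω), ← hμ.sum_eq v, mul_sum]
  refine sum_congr rfl fun x _ => ?_
  simp only [Function.Involutive.coe_toPerm, Function.update_idem, Function.update_eq_self]
  rw [← mul_assoc, ← hw]
  ring

lemma expect_apply (hμ : IsProb μ) (v : V) (g : β → ℝ) :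
    expect μ (fun ω => g (ω v)) = ∑ x, μ v x * g x := by
  rw [expect_update hμ v]
  simp [expect_const hμ]

lemma expect_mul (hμ : IsProb μ) {T T' : Finset V} (hT : Disjoint T T') {f g : (V → β) → ℝ}
    (hf : DependsOn f T) (hg : DependsOn g T') :
    expect μ (fun ω => f ω * g ω) = expect μ f * expect μ g := by
  have inv : Function.Involutive
      fun z : (V → β) × (V → β) => (T.piecewise z.1 z.2, T.piecewise z.2 z.1) := by
    rintro ⟨ω, ω'⟩
    ext v <;> by_cases hv : v ∈ T <;> simp [hv]
  have key : expect μ f * expect μ g = ∑ z : (V → β) × (V → β),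
      (∏ v, μ v (z.1 v)) * (∏ v, μ v (z.2 v)) * (f z.1 * g z.2) := by
    rw [expect, expect, sum_mul_sum, Fintype.sum_prod_type]
    exact sum_congr rfl fun _ _ => sum_congr rfl fun _ _ => by ring
  have key' : expect μ (fun ω => f ω * g ω) = ∑ z : (V → β) × (V → β),
      (∏ v, μ v (z.1 v)) * (∏ v, μ v (z.2 v)) * (f z.1 * g z.1) := by
    rw [← mul_one (expect μ _), ← expect_const hμ 1, expect, expect, sum_mul_sum,
      Fintype.sum_prod_type]
    exact sum_congr rfl fun _ _ => sum_congr rfl fun _ _ => by ring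
  rw [key, key', ← Equiv.sum_comp inv.toPerm]
  refine sum_congr rfl fun z _ => ?_
  simp only [Function.Involutive.coe_toPerm]
  congr 1
  · rw [← prod_mul_distrib, ← prod_mul_distrib]
    refine prod_congr rfl fun v _ => ?_
    by_cases hv : v ∈ T <;> simp [hv, mul_comm]
  · congr 1
    · exact hf fun v hv => by simp [Finset.mem_coe.1 hv]
    · exact hg fun v hv => by simp [disjoint_right.1 hT (Finset.mem_coe.1 hv)]

lemma exists_of_prob_pos {A : (V → β) → Prop} (h : 0 < prob μ A) :
    ∃ ω, A ω ∧ ∀ v, μ v (ω v) ≠ 0 := by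
  obtain ⟨ω, -, hω⟩ := exists_ne_zero_of_sum_ne_zero h.ne'
  refine ⟨ω, ?_, fun v => ?_⟩
  · by_contra hA
    simp [hA] at hω
  · exact prod_ne_zero_iff.1 (left_ne_zero_of_mul hω) v (mem_univ v)

/-- The Lovász local lemma for product spaces. -/
lemma exists_forall_not (hμ : IsProb μ) {κ : Type*} [Fintype κ] (A : κ → (V → β) → Prop)
    (T : κ → Finset V) (hA : ∀ k, DependsOn (A k) (T k)) (h4 : ∀ k, prob μ (A k) ≤ 1 / 4)
    (hT : ∀ k, ∑ l with ¬ Disjoint (T k) (T l), prob μ (A l) ≤ 1 / 4) :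
    ∃ ω, (∀ k, ¬ A k ω) ∧ ∀ v, μ v (ω v) ≠ 0 := by
  classical
  set Q : Finset κ → ℝ := fun s => prob μ fun ω => ∀ k ∈ s, ¬ A k ω with hQ
  have hQ0 : ∀ s, 0 ≤ Q s := fun s => prob_nonneg hμ _
  have union : ∀ s t : Finset κ,
      Q s ≤ Q (s ∪ t) + ∑ k ∈ t, prob μ fun ω => A k ω ∧ ∀ l ∈ s, ¬ A l ω := by
    intro s t
    refine le_trans (prob_mono hμ fun ω hω => ?_)
      ((prob_or_le hμ _ _).trans (add_le_add le_rfl (prob_exists_le hμ t _)))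
    by_cases h : ∃ k ∈ t, A k ω
    · obtain ⟨k, hk, h⟩ := h
      exact Or.inr ⟨k, hk, h, hω⟩
    · push Not at h
      refine Or.inl fun k hk => ?_
      rcases mem_union.1 hk with hk | hk
      exacts [hω k hk, h k hk]
  have main : ∀ n, ∀ s : Finset κ, s.card ≤ n → ∀ k,
      (prob μ fun ω => A k ω ∧ ∀ l ∈ s, ¬ A l ω) ≤ 2 * prob μ (A k) * Q s := by
    intro n
    induction n with
    | zero =>
      intro s hs k
      obtain rfl : s = ∅ := by simpa using hs
      have : Q ∅ = 1 := by simp [hQ, prob, expect_const hμ]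
      rw [this]
      simp only [notMem_empty, false_imp_iff, implies_true, and_true]
      linarith [prob_nonneg hμ (A k)]
    | succ n ih =>
      intro s hs k
      set s₁ := s.filter fun l => ¬ Disjoint (T k) (T l) with hs₁
      set s₂ := s.filter fun l => Disjoint (T k) (T l) with hs₂
      have hs12 : s₂ ∪ s₁ = s := filter_union_filter_not_eq _ s
      have hind : (prob μ fun ω => A k ω ∧ ∀ l ∈ s₂, ¬ A l ω) = prob μ (A k) * Q s₂ := by
        have hd : Disjoint (T k) (s₂.biUnion T) :=
          (disjoint_biUnion_right _ _ _).2 fun l hl => (mem_filter.1 hl).2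
        simp only [hQ, prob]
        rw [← expect_mul hμ hd]
        · congr 1
          ext ω
          by_cases h : A k ω <;> simp [h]
        · intro ω ω' h
          simp only [hA k h]
        · intro ω ω' h
          have : ∀ l ∈ s₂, A l ω = A l ω' := fun l hl =>
            hA l fun v hv => h v (mem_coe.2 (mem_biUnion.2 ⟨l, hl, hv⟩))
          have e : (∀ l ∈ s₂, ¬ A l ω) ↔ (∀ l ∈ s₂, ¬ A l ω') :=
            forall₂_congr fun l hl => by rw [this l hl]
          by_cases h : ∀ l ∈ s₂, ¬ A l ω'
          · beta_reduce
            rw [if_pos h, if_pos (e.2 h)]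
          · beta_reduce
            rw [if_neg h, if_neg (mt e.1 h)]
      have h1 : (prob μ fun ω => A k ω ∧ ∀ l ∈ s, ¬ A l ω) ≤ prob μ (A k) * Q s₂ := by
        rw [← hind]
        exact prob_mono hμ fun ω hω => ⟨hω.1, fun l hl => hω.2 l (mem_filter.1 hl).1⟩
      have h2 : Q s₂ ≤ 2 * Q s := by
        rcases s₁.eq_empty_or_nonempty with he | hne
        · rw [he, union_empty] at hs12
          rw [hs12]
          linarith [hQ0 s]
        have hc : s₂.card ≤ n := by
          obtain ⟨l, hl⟩ := hne
          obtain ⟨hl, hl'⟩ := mem_filter.1 hl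
          have : s₂.card < s.card := card_lt_card (filter_ssubset.2 ⟨l, hl, hl'⟩)
          omega
        have h3 := union s₂ s₁
        rw [hs12] at h3
        have h4 : ∑ l ∈ s₁, (prob μ fun ω => A l ω ∧ ∀ l ∈ s₂, ¬ A l ω) ≤ 1 / 2 * Q s₂ := by
          calc _ ≤ ∑ l ∈ s₁, 2 * prob μ (A l) * Q s₂ := sum_le_sum fun l _ => ih s₂ hc l
            _ = 2 * Q s₂ * ∑ l ∈ s₁, prob μ (A l) := by
              rw [mul_sum]; exact sum_congr rfl fun _ _ => by ring
            _ ≤ 2 * Q s₂ * (1 / 4) := by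
              refine mul_le_mul_of_nonneg_left (le_trans ?_ (hT k)) (by linarith [hQ0 s₂])
              exact sum_le_sum_of_subset_of_nonneg
                (fun l hl => mem_filter.2 ⟨mem_univ l, (mem_filter.1 hl).2⟩)
                fun l _ _ => prob_nonneg hμ _
            _ = _ := by ring
        linarith
      nlinarith [prob_nonneg hμ (A k)]
  have pos : ∀ s : Finset κ, 0 < Q s := by
    intro s
    induction s using Finset.induction_on with
    | empty => simp [hQ, prob, expect_const hμ]
    | insert k s _ ih =>
      have h3 := union s {k}
      rw [union_comm, ← insert_eq, sum_singleton] at h3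
      nlinarith [main _ s le_rfl k, h4 k]
  simpa using exists_of_prob_pos (pos univ)

end Product

section Concentration

variable {V β : Type*} [Fintype V] [DecidableEq V] [Fintype β] {μ : V → β → ℝ}

lemma prob_gt_le (hμ : IsProb μ) {f : (V → β) → ℝ} {l a b t : ℝ} (hl : 0 ≤ l)
    (h : expect μ (fun ω => Real.exp (l * f ω)) ≤ Real.exp (l * a + b)) :
    prob μ (fun ω => a + t < f ω) ≤ Real.exp (b - l * t) := by
  calc prob μ (fun ω => a + t < f ω)
      ≤ expect μ fun ω => Real.exp (-(l * (a + t))) * Real.exp (l * f ω) := by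
        refine expect_mono hμ fun ω => ?_
        split_ifs with hω
        · rw [← Real.exp_add]
          exact Real.one_le_exp (by nlinarith)
        · positivity
    _ ≤ Real.exp (-(l * (a + t))) * Real.exp (l * a + b) := by
        rw [expect_const_mul]
        gcongr
    _ = _ := by
        rw [← Real.exp_add]
        ring_nf

/-- A one-coordinate exponential moment bound. -/
lemma sum_mul_exp_le {ν : β → ℝ} (hν : ∀ x, 0 ≤ ν x) (hν1 : ∑ x, ν x = 1) {g h : β → ℝ}
    {g₀ l : ℝ} (hl : 0 ≤ l) (hlh : ∀ x, l * h x ≤ 1) (hg : ∀ x, |g x - g₀| ≤ h x) :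
    ∑ x, ν x * Real.exp (l * g x) ≤
      Real.exp (l * (∑ x, ν x * g x) + l ^ 2 * ∑ x, ν x * h x ^ 2) := by
  have hpt : ∀ x, Real.exp (l * (g x - g₀)) ≤ 1 + l * (g x - g₀) + l ^ 2 * h x ^ 2 := by
    intro x
    have h1 : |l * (g x - g₀)| ≤ l * h x := by
      rw [abs_mul, abs_of_nonneg hl]
      exact mul_le_mul_of_nonneg_left (hg x) hl
    have h2 := (abs_le.1 (Real.abs_exp_sub_one_sub_id_le (h1.trans (hlh x)))).2
    have h3 : (l * (g x - g₀)) ^ 2 ≤ (l * h x) ^ 2 := sq_le_sq' (neg_le_of_abs_le h1)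
      (le_of_abs_le h1)
    nlinarith
  calc ∑ x, ν x * Real.exp (l * g x)
      = Real.exp (l * g₀) * ∑ x, ν x * Real.exp (l * (g x - g₀)) := by
        rw [mul_sum]
        refine sum_congr rfl fun x _ => ?_
        rw [mul_left_comm, ← Real.exp_add]
        ring_nf
    _ ≤ Real.exp (l * g₀) * ∑ x, ν x * (1 + l * (g x - g₀) + l ^ 2 * h x ^ 2) := by
        gcongr with x
        exacts [hν x, hpt x]
    _ = Real.exp (l * g₀) *
        ((l * (∑ x, ν x * g x) + l ^ 2 * ∑ x, ν x * h x ^ 2 - l * g₀) + 1) := by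
        have : ∀ x, ν x * (1 + l * (g x - g₀) + l ^ 2 * h x ^ 2) =
            ν x * (1 - l * g₀) + l * (ν x * g x) + l ^ 2 * (ν x * h x ^ 2) := fun x => by ring
        simp only [this, sum_add_distrib, ← mul_sum, ← sum_mul, hν1]
        ring
    _ ≤ Real.exp (l * g₀) *
        Real.exp (l * (∑ x, ν x * g x) + l ^ 2 * ∑ x, ν x * h x ^ 2 - l * g₀) := by
        gcongr
        exact Real.add_one_le_exp _
    _ = _ := by
        rw [← Real.exp_add]
        ring_nf

/-- An exponential moment bound for functions of independent variables, in terms of the second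
moments of the influence of the coordinates. -/
lemma expect_exp_le (hμ : IsProb μ) (x₀ : β) {h : V → β → ℝ} {l : ℝ} (hl : 0 ≤ l)
    (hlh : ∀ v x, l * h v x ≤ 1) (T : Finset V) :
    ∀ f : (V → β) → ℝ, DependsOn f T →
      (∀ ω v x, |f (Function.update ω v x) - f (Function.update ω v x₀)| ≤ h v x) →
      expect μ (fun ω => Real.exp (l * f ω)) ≤
        Real.exp (l * expect μ f + l ^ 2 * ∑ v ∈ T, ∑ x, μ v x * h v x ^ 2) := by
  induction T using Finset.induction_on with
  | empty =>
    intro f hf _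
    have hc : ∀ ω, f ω = f fun _ => x₀ := fun ω => hf (by simp)
    have : f = fun _ => f fun _ => x₀ := funext hc
    rw [this]
    simp [expect_const hμ]
  | insert v T hv ih =>
    intro f hf hfh
    set g : (V → β) → ℝ := fun ω => ∑ x, μ v x * f (Function.update ω v x) with hg
    have hgT : DependsOn g T := by
      intro ω ω' hω
      refine sum_congr rfl fun x _ => ?_
      congr 1
      refine hf fun u hu => ?_
      by_cases huv : u = v
      · subst huv; simp
      · rw [Function.update_of_ne huv, Function.update_of_ne huv]
        exact hω u ((mem_insert.1 (mem_coe.1 hu)).resolve_left huv)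
    have hgh : ∀ ω u x, |g (Function.update ω u x) - g (Function.update ω u x₀)| ≤ h u x := by
      intro ω u x
      have hux : 0 ≤ h u x := (abs_nonneg _).trans (hfh ω u x)
      by_cases huv : u = v
      · subst huv
        simpa [hg] using hux
      · simp only [hg, ← sum_sub_distrib, ← mul_sub]
        calc _ ≤ ∑ y, |μ v y * (f (Function.update (Function.update ω u x) v y) -
              f (Function.update (Function.update ω u x₀) v y))| := abs_sum_le_sum_abs _ _
          _ ≤ ∑ y, μ v y * h u x := by
              refine sum_le_sum fun y _ => ?_
              rw [abs_mul, abs_of_nonneg (hμ.nonneg v y), Function.update_comm huv,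
                Function.update_comm huv]
              exact mul_le_mul_of_nonneg_left (hfh _ u x) (hμ.nonneg v y)
          _ = h u x := by rw [← sum_mul, hμ.sum_eq, one_mul]
    have hge : expect μ g = expect μ f := (expect_update hμ v f).symm
    rw [expect_update hμ v]
    calc _ ≤ expect μ fun ω => Real.exp (l ^ 2 * ∑ x, μ v x * h v x ^ 2) *
          Real.exp (l * g ω) := by
          refine expect_mono hμ fun ω => ?_
          rw [← Real.exp_add, add_comm]
          exact sum_mul_exp_le (hμ.nonneg v) (hμ.sum_eq v) hl (hlh v) (hfh ω v)
      _ ≤ Real.exp (l ^ 2 * ∑ x, μ v x * h v x ^ 2) *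
          Real.exp (l * expect μ f + l ^ 2 * ∑ v ∈ T, ∑ x, μ v x * h v x ^ 2) := by
          rw [expect_const_mul, ← hge]
          gcongr
          exact ih g hgT hgh
      _ = _ := by
          rw [← Real.exp_add, sum_insert hv]
          ring_nf

/-- Upper tail bound for functions of independent variables. -/
lemma prob_gt_le_of_influence (hμ : IsProb μ) (x₀ : β) {h : V → β → ℝ} {l a t s : ℝ}
    (hl : 0 ≤ l) (hlh : ∀ v x, l * h v x ≤ 1) {f : (V → β) → ℝ}
    (hf : ∀ ω v x, |f (Function.update ω v x) - f (Function.update ω v x₀)| ≤ h v x)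
    (ha : expect μ f ≤ a) (hs : ∑ v, ∑ x, μ v x * h v x ^ 2 ≤ s) :
    prob μ (fun ω => a + t < f ω) ≤ Real.exp (l ^ 2 * s - l * t) := by
  refine prob_gt_le hμ hl ((expect_exp_le hμ x₀ hl hlh univ f ?_ hf).trans ?_)
  · intro ω ω' h
    rw [funext fun v => h v (by simp)]
  · gcongr

open Classical in
/-- An exponential moment bound for a sum of events revealed one vertex at a time. -/
lemma expect_exp_sequential_le (hμ : IsProb μ) {r : V → ℕ} (hr : Function.Injective r)
    {Y : V → (V → β) → Prop} (hY : ∀ u, DependsOn (Y u) {w | r w ≤ r u}) {q l : ℝ} (hl : 0 ≤ l)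
    (hq : ∀ u ω, (∑ x, μ u x * if Y u (Function.update ω u x) then 1 else 0) ≤ q) {a : V → ℝ}
    (ha : ∀ u, 0 ≤ a u) (hla : ∀ u, l * a u ≤ 1) (N : Finset V) :
    expect μ (fun ω => Real.exp (l * ∑ u ∈ N, a u * if Y u ω then 1 else 0)) ≤
      Real.exp (2 * l * q * ∑ u ∈ N, a u) := by
  induction N using Finset.induction_on_max_value r with
  | empty => simp [expect_const hμ]
  | insert u N hu hmax ih =>
    rw [expect_update hμ u]
    calc _ ≤ expect μ fun ω => Real.exp (2 * l * q * a u) *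
          Real.exp (l * ∑ u ∈ N, a u * if Y u ω then 1 else 0) := by
          refine expect_mono hμ fun ω => ?_
          have hN : ∀ x, (∑ w ∈ N, a w * if Y w (Function.update ω u x) then (1 : ℝ) else 0) =
              ∑ w ∈ N, a w * if Y w ω then 1 else 0 := by
            refine fun x => sum_congr rfl fun w hw => ?_
            have : Y w (Function.update ω u x) = Y w ω := by
              refine hY w fun z hz => Function.update_of_ne ?_ _ _
              rintro rfl
              exact hu (hr (le_antisymm (hmax w hw) hz) ▸ hw)
            simp only [this]
          have hx : ∀ x, Real.exp (l * (a u * if Y u (Function.update ω u x) then 1 else 0)) ≤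
              1 + 2 * l * a u * if Y u (Function.update ω u x) then 1 else 0 := by
            intro x
            split_ifs
            · have h0 := mul_nonneg hl (ha u)
              have := (abs_le.1 (Real.abs_exp_sub_one_sub_id_le (x := l * a u)
                (by rw [abs_of_nonneg h0]; exact hla u))).2
              rw [mul_one, mul_one]
              nlinarith [hla u]
            · simp
          simp only [sum_insert hu, hN, mul_add, Real.exp_add]
          simp only [← mul_assoc, ← sum_mul]
          refine mul_le_mul_of_nonneg_right ?_ (Real.exp_nonneg _)
          calc _ ≤ ∑ x, μ u x * (1 + 2 * l * a u *
                if Y u (Function.update ω u x) then 1 else 0) := by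
                refine sum_le_sum fun x _ => mul_le_mul_of_nonneg_left ?_ (hμ.nonneg u x)
                simpa only [mul_assoc] using hx x
            _ = 2 * l * a u * (∑ x, μ u x * if Y u (Function.update ω u x) then 1 else 0)
                + 1 := by
                simp only [mul_add, mul_one, sum_add_distrib, hμ.sum_eq, mul_left_comm (μ u _),
                  ← mul_sum]
                ring
            _ ≤ 2 * l * a u * q + 1 := by
                have := ha u
                gcongr
                exact hq u ω
            _ ≤ _ := by
                refine le_trans (Real.add_one_le_exp _) (le_of_eq ?_)
                ring_nf
      _ ≤ _ := by
          rw [expect_const_mul, sum_insert hu, mul_add, Real.exp_add]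
          gcongr

end Concentration

section System

open scoped Classical

variable {V α ι : Type*} [Fintype V] [Fintype α] [Fintype ι]

/-- A conflict relation `M` on pairs (vertex, color), supported on the lists `L`, which is a
matching between any two vertices, and whose conflicts are covered by nearly disjoint sets `S i`
such that all color degrees within each `S i` are at most `D`. -/
structure IsSystem (S : ι → Finset V) (L : V → Finset α) (M : V × α → V × α → Prop)
    (K Λ D : ℕ) : Prop where
  symm : ∀ {q r}, M q r → M r q
  matching : ∀ {q r r'}, M q r → M q r' → r.1 = r'.1 → r = r'
  irrefl : ∀ {q r}, M q r → q.1 ≠ r.1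
  exists_common : ∀ {q r}, M q r → ∃ i, q.1 ∈ S i ∧ r.1 ∈ S i
  nearlyDisjoint : ∀ {i j}, i ≠ j → (S i ∩ S j).card ≤ 1
  card_le : ∀ v, (univ.filter fun i => v ∈ S i).card ≤ K
  mem_list : ∀ {q r}, M q r → q.2 ∈ L q.1
  card_list : ∀ v, (L v).card ≤ Λ * D
  degree_le : ∀ i, ∀ v ∈ S i, ∀ c, (univ.filter fun r => r.1 ∈ S i ∧ M (v, c) r).card ≤ D

/-- Weights on the colors of the uncolored vertices `U`, which form a probability vector at every
vertex of `U`, with weighted color degrees at most `ρ` within each `S i`. -/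
structure IsWeighting (S : ι → Finset V) (M : V × α → V × α → Prop) (w : V × α → ℝ)
    (U : Finset V) (ρ b : ℝ) : Prop where
  nonneg : ∀ q, 0 ≤ w q
  le : ∀ q, w q ≤ b
  sum_eq : ∀ v ∈ U, ∑ c, w (v, c) = 1
  eq_zero : ∀ v ∉ U, ∀ c, w (v, c) = 0
  degree_le : ∀ i, ∀ v ∈ S i, ∀ c, ∑ r with r.1 ∈ S i ∧ M (v, c) r, w r ≤ ρ

/-- There is a conflict-free coloring of `U` using colors of positive weight. -/
def IsColorable (M : V × α → V × α → Prop) (w : V × α → ℝ) (U : Finset V) : Prop :=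
  ∃ φ : V → α, (∀ v ∈ U, w (v, φ v) ≠ 0) ∧ ∀ u ∈ U, ∀ v ∈ U, ¬ M (u, φ u) (v, φ v)

/-- The total weight of the pairs in conflict with `q`. -/
noncomputable def totalWeight (M : V × α → V × α → Prop) (w : V × α → ℝ) (q : V × α) : ℝ :=
  ∑ r with M q r, w r

/-- The distribution of the tentative color of each vertex, if vertices are activated with
probability `p`. -/
noncomputable def activation (p : ℝ) (w : V × α → ℝ) (v : V) : Option α → ℝ
  | none => 1 - p * ∑ c, w (v, c)
  | some c => p * w (v, c)

lemma activation_none (p : ℝ) (w : V × α → ℝ) (v : V) :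
    activation p w v none = 1 - p * ∑ c, w (v, c) := rfl

lemma activation_some (p : ℝ) (w : V × α → ℝ) (v : V) (c : α) :
    activation p w v (some c) = p * w (v, c) := rfl

variable {S : ι → Finset V} {L : V → Finset α} {M : V × α → V × α → Prop} {K Λ D : ℕ}
  {w W : V × α → ℝ} {U : Finset V} {ρ b p : ℝ}

lemma IsSystem.sum_le (hS : IsSystem S L M K Λ D) {f : V × α → ℝ} (hf : ∀ q, 0 ≤ f q) {a : ℝ}
    (ha : 0 ≤ a) (h : ∀ i, ∀ v ∈ S i, ∀ c, ∑ r with r.1 ∈ S i ∧ M (v, c) r, f r ≤ a)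
    (q : V × α) : ∑ r with M q r, f r ≤ K * a := by
  calc ∑ r with M q r, f r
      ≤ ∑ r with M q r, ∑ i with q.1 ∈ S i, if r.1 ∈ S i then f r else 0 := by
        refine sum_le_sum fun r hr => ?_
        obtain ⟨i, hi, hi'⟩ := hS.exists_common (mem_filter.1 hr).2
        refine le_trans ?_ (single_le_sum (f := fun i => if r.1 ∈ S i then f r else 0)
          (fun j _ => ?_) (mem_filter.2 ⟨mem_univ i, hi⟩))
        · simp [hi']
        · split_ifs
          exacts [hf r, le_rfl]
    _ = ∑ i with q.1 ∈ S i, ∑ r with r.1 ∈ S i ∧ M q r, f r := by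
        rw [sum_comm]
        simp only [← sum_filter, filter_filter, and_comm]
    _ ≤ ∑ i with q.1 ∈ S i, a :=
        sum_le_sum fun i hi => h i q.1 (mem_filter.1 hi).2 q.2
    _ ≤ K * a := by
        rw [sum_const, nsmul_eq_mul]
        gcongr
        exact hS.card_le _

lemma IsWeighting.sum_le_one (hw : IsWeighting S M w U ρ b) (v : V) : ∑ c, w (v, c) ≤ 1 := by
  by_cases hv : v ∈ U
  · exact (hw.sum_eq v hv).le
  · simp [hw.eq_zero v hv]

lemma IsWeighting.isProb (hw : IsWeighting S M w U ρ b) (hp : 0 ≤ p) (hp1 : p ≤ 1) :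
    IsProb (activation p w) where
  nonneg v x := by
    cases x with
    | none =>
      rw [activation_none]
      nlinarith [hw.sum_le_one v, sum_nonneg fun c (_ : c ∈ univ) => hw.nonneg (v, c)]
    | some c => exact mul_nonneg hp (hw.nonneg _)
  sum_eq v := by
    rw [Fintype.sum_option, activation_none]
    simp [activation_some, ← mul_sum]

lemma IsSystem.totalWeight_le (hS : IsSystem S L M K Λ D) (hw : IsWeighting S M w U ρ b)
    (hρ : 0 ≤ ρ) (q : V × α) : totalWeight M w q ≤ K * ρ :=
  hS.sum_le hw.nonneg hρ hw.degree_le q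

lemma totalWeight_nonneg (hw : ∀ q, 0 ≤ w q) (q : V × α) : 0 ≤ totalWeight M w q :=
  sum_nonneg fun r _ => hw r

/-- An upper bound for the total `W`-weight of the colors at `v` that are in conflict with
tentative colors. -/
noncomputable def hitWeight (M : V × α → V × α → Prop) (W : V × α → ℝ) (v : V)
    (ω : V → Option α) : ℝ :=
  ∑ c, W (v, c) * ∑ r with M (v, c) r, if ω r.1 = some r.2 then 1 else 0

lemma expect_hitWeight (hμ : IsProb (activation p w)) (v : V) :
    expect (activation p w) (hitWeight M W v) =
      ∑ c, W (v, c) * (p * totalWeight M w (v, c)) := by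
  have h1 : ∀ r : V × α, expect (activation p w) (fun ω => if ω r.1 = some r.2 then 1 else 0) =
      p * w r := by
    intro r
    rw [expect_apply hμ r.1 fun x => if x = some r.2 then 1 else 0]
    simp [activation_some]
  change expect _ (fun ω => hitWeight M W v ω) = _
  simp only [hitWeight, expect_sum, expect_const_mul, h1, totalWeight, mul_sum]

lemma hitWeight_update_sub (v u : V) (ω : V → Option α) (y : α) :
    hitWeight M W v (Function.update ω u (some y)) - hitWeight M W v (Function.update ω u none) =
      ∑ c, W (v, c) * if M (v, c) (u, y) then 1 else 0 := by
  simp only [hitWeight, ← sum_sub_distrib, ← mul_sub]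
  refine sum_congr rfl fun c _ => ?_
  congr 1
  have : ∀ r : V × α, ((if Function.update ω u (some y) r.1 = some r.2 then (1 : ℝ) else 0) -
      if Function.update ω u none r.1 = some r.2 then 1 else 0) =
      if (u, y) = r then 1 else 0 := by
    rintro ⟨z, x⟩
    by_cases hz : z = u
    · subst hz; simp
    · simp [Function.update_of_ne hz, Ne.symm hz]
  simp only [this]
  simp [sum_ite_eq]

lemma IsSystem.prob_hitWeight_le (hS : IsSystem S L M K Λ D) (hμ : IsProb (activation p w))
    (hW : ∀ q, 0 ≤ W q) {b l a t : ℝ} (hb : 0 ≤ b) (hWb : ∀ q, W q ≤ b) (hl : 0 ≤ l)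
    (hlb : l * b ≤ 1) {v : V} (ha : ∑ c, W (v, c) * (p * totalWeight M w (v, c)) ≤ a) :
    prob (activation p w) (fun ω => a + t < hitWeight M W v ω) ≤
      Real.exp (l ^ 2 * (b * a) - l * t) := by
  set h : V → Option α → ℝ := fun u x =>
    x.elim 0 fun y => ∑ c, W (v, c) * if M (v, c) (u, y) then 1 else 0 with hh
  have h0 : ∀ u x, 0 ≤ h u x := by
    rintro u (_ | y)
    · simp [hh]
    · exact sum_nonneg fun c _ => mul_nonneg (hW _) (by positivity)
  have hle : ∀ u x, h u x ≤ b := by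
    rintro u (_ | y)
    · simpa [hh] using hb
    · simp only [hh, Option.elim, mul_ite, mul_one, mul_zero, ← sum_filter]
      rcases (univ.filter fun c => M (v, c) (u, y)).eq_empty_or_nonempty with he | ⟨c, hc⟩
      · simpa [he] using hb
      · rw [eq_singleton_iff_unique_mem.2 ⟨hc, fun c' hc' => ?_⟩]
        · simpa using hWb _
        · exact (Prod.ext_iff.1 (hS.matching (hS.symm (mem_filter.1 hc').2)
            (hS.symm (mem_filter.1 hc).2) rfl)).2
  refine prob_gt_le_of_influence hμ none hl (h := h) (fun u x => ?_) ?_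
    ((expect_hitWeight hμ v).trans_le ha) ?_
  · exact (mul_le_mul_of_nonneg_left (hle u x) hl).trans hlb
  · rintro ω u (_ | y)
    · simpa using h0 u none
    · rw [hitWeight_update_sub]
      exact (abs_of_nonneg (h0 u (some y))).le
  · calc ∑ u, ∑ x, activation p w u x * h u x ^ 2
        ≤ ∑ u, ∑ x, b * (activation p w u x * h u x) := by
          refine sum_le_sum fun u _ => sum_le_sum fun x _ => ?_
          nlinarith [mul_nonneg (hμ.nonneg u x) (h0 u x), hle u x]
      _ = b * ∑ c, W (v, c) * (p * totalWeight M w (v, c)) := by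
          simp only [← mul_sum]
          congr 1
          simp only [Fintype.sum_option, hh, Option.elim, mul_zero, zero_add, activation_some]
          rw [← Fintype.sum_prod_type' fun u y => p * w (u, y) *
            ∑ c, W (v, c) * if M (v, c) (u, y) then 1 else 0]
          simp only [totalWeight, mul_sum, sum_filter]
          rw [sum_comm]
          refine sum_congr rfl fun c _ => sum_congr rfl fun r _ => ?_
          split_ifs <;> ring
      _ ≤ b * a := by gcongr

end System

section Idle

open scoped Classical

variable {V α ι : Type*} [Fintype V] [Fintype α] [Fintype ι]
  {S : ι → Finset V} {L : V → Finset α} {M : V × α → V × α → Prop} {K Λ D : ℕ}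
  {w W : V × α → ℝ} {U : Finset V} {ρ b p : ℝ}

/-- The vertex of `q` stays inactive and no tentative color outside `T` is in conflict with `q`. -/
def IsIdle (M : V × α → V × α → Prop) (T : Finset V) (q : V × α) (ω : V → Option α) : Prop :=
  ω q.1 = none ∧ ∀ r, M q r → r.1 ∉ T → ω r.1 ≠ some r.2

/-- The total weight of the idle pairs within `T` in conflict with `q`. -/
noncomputable def idleWeight (M : V × α → V × α → Prop) (W : V × α → ℝ) (T : Finset V)
    (q : V × α) (ω : V → Option α) : ℝ :=
  ∑ r with r.1 ∈ T ∧ M q r, W r * if IsIdle M T r ω then 1 else 0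

lemma prob_isIdle_le (hM : ∀ {q r}, M q r → q.1 ≠ r.1)
    (hμ : IsProb (activation p w)) (T : Finset V) (q : V × α) :
    prob (activation p w) (IsIdle M T q) ≤
      activation p w q.1 none * Real.exp (-(p * ∑ r with M q r ∧ r.1 ∉ T, w r)) := by
  set e : V → ℝ := fun u => p * ∑ y, if M q (u, y) ∧ u ∉ T then w (u, y) else 0 with he
  set g : V → Option α → ℝ := fun u o =>
    if (u = q.1 → o = none) ∧ ∀ y, M q (u, y) → u ∉ T → o ≠ some y then 1 else 0 with hg
  have hprod : prob (activation p w) (IsIdle M T q) =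
      ∏ u, ∑ x, activation p w u x * g u x := by
    rw [← expect_prod, prob]
    congr 1
    ext ω
    simp only [hg, prod_ite_zero, prod_const_one]
    congr 1
    simp only [IsIdle, mem_univ, true_imp_iff, eq_iff_iff, Prod.forall]
    constructor
    · exact fun h u => ⟨fun hu => hu ▸ h.1, h.2 u⟩
    · exact fun h => ⟨(h q.1).1 rfl, fun u => (h u).2⟩
  have hfac : ∀ u, ∑ x, activation p w u x * g u x ≤
      (if u = q.1 then activation p w q.1 none else 1) * Real.exp (-e u) := by
    intro u
    rw [Fintype.sum_option]
    by_cases hu : u = q.1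
    · subst hu
      have h1 : ∀ y, ¬ M q (q.1, y) := fun y h => hM h rfl
      simp [hg, he, h1]
    · rw [if_neg hu, one_mul]
      refine le_trans (le_of_eq ?_) (Real.add_one_le_exp (-e u))
      have h1 : ∀ y, activation p w u (some y) * g u (some y) =
          activation p w u (some y) - p * if M q (u, y) ∧ u ∉ T then w (u, y) else 0 := by
        intro y
        by_cases h : M q (u, y) ∧ u ∉ T
        · have : g u (some y) = 0 := if_neg fun h' => h'.2 y h.1 h.2 rfl
          rw [this, if_pos h, activation_some]
          ring
        · have : g u (some y) = 1 := by
            refine if_pos ⟨fun h => absurd h hu, fun z hz hT hzy => h ⟨?_, hT⟩⟩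
            rwa [Option.some.inj hzy]
          rw [this, if_neg h]
          ring
      have h2 : g u none = 1 := if_pos ⟨fun _ => rfl, fun _ _ _ => nofun⟩
      have h3 := hμ.sum_eq u
      rw [Fintype.sum_option] at h3
      simp only [h1, h2, sum_sub_distrib, he, ← mul_sum]
      linarith
  have hnn : ∀ u, 0 ≤ ∑ x, activation p w u x * g u x := fun u =>
    sum_nonneg fun x _ => mul_nonneg (hμ.nonneg u x) (by simp only [hg]; positivity)
  rw [hprod]
  refine (prod_le_prod (fun u _ => hnn u) fun u _ => hfac u).trans (le_of_eq ?_)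
  rw [prod_mul_distrib, ← Real.exp_sum, prod_ite_eq' univ q.1 fun _ => activation p w q.1 none]
  simp only [mem_univ, if_true]
  congr 2
  simp only [he, sum_neg_distrib, ← mul_sum, sum_filter]
  rw [Fintype.sum_prod_type]

lemma IsSystem.expect_idleWeight_le (hS : IsSystem S L M K Λ D)
    (hw : IsWeighting S M w U ρ b) (hp : 0 ≤ p) (hp1 : p ≤ 1) {i : ι} {v : V} (hv : v ∈ S i)
    (c : α) :
    expect (activation p w)
      (idleWeight M (fun q => w q * Real.exp (p * totalWeight M w q)) (S i) (v, c)) ≤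
      ρ * (Real.exp (p * ρ) * (1 - p)) := by
  have hμ := hw.isProb hp hp1
  have hterm : ∀ q : V × α, q.1 ∈ S i →
      w q * Real.exp (p * totalWeight M w q) * prob (activation p w) (IsIdle M (S i) q) ≤
        w q * (Real.exp (p * ρ) * (1 - p)) := by
    intro q hq
    by_cases hqU : q.1 ∈ U
    · have h1 : activation p w q.1 none = 1 - p := by
        rw [activation_none, hw.sum_eq _ hqU, mul_one]
      have h2 := prob_isIdle_le hS.irrefl hμ (S i) q
      rw [h1] at h2
      have h3 : totalWeight M w q ≤ ρ + ∑ r with M q r ∧ r.1 ∉ S i, w r := by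
        have := hw.degree_le i q.1 hq q.2
        rw [totalWeight, ← sum_filter_add_sum_filter_not _ (fun r => r.1 ∈ S i), filter_filter,
          filter_filter]
        simp only [and_comm (a := _ ∈ S i)] at this
        gcongr
      rw [mul_assoc]
      refine mul_le_mul_of_nonneg_left ?_ (hw.nonneg q)
      calc _ ≤ Real.exp (p * totalWeight M w q) *
            ((1 - p) * Real.exp (-(p * ∑ r with M q r ∧ r.1 ∉ S i, w r))) := by gcongr
        _ = Real.exp (p * (totalWeight M w q - ∑ r with M q r ∧ r.1 ∉ S i, w r)) * (1 - p) := by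
          rw [mul_left_comm, ← Real.exp_add, mul_comm]
          ring_nf
        _ ≤ _ := by
          have : 0 ≤ 1 - p := by linarith
          gcongr
          linarith
    · simp [show w q = 0 from hw.eq_zero q.1 hqU q.2]
  have hexp : expect (activation p w)
      (idleWeight M (fun q => w q * Real.exp (p * totalWeight M w q)) (S i) (v, c)) =
      ∑ q with q.1 ∈ S i ∧ M (v, c) q, w q * Real.exp (p * totalWeight M w q) *
        prob (activation p w) (IsIdle M (S i) q) := by
    change expect _ (fun ω => idleWeight M _ (S i) (v, c) ω) = _
    simp only [idleWeight, expect_sum, expect_const_mul, prob]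
  rw [hexp]
  calc _ ≤ ∑ q with q.1 ∈ S i ∧ M (v, c) q, w q * (Real.exp (p * ρ) * (1 - p)) :=
        sum_le_sum fun q hq => hterm q (mem_filter.1 hq).2.1
    _ ≤ _ := by
        rw [← sum_mul]
        have : 0 ≤ 1 - p := by linarith
        gcongr
        exact hw.degree_le i v hv c

lemma IsSystem.card_influence_le (hS : IsSystem S L M K Λ D) (i : ι) (q : V × α) (u : V)
    (y : α) :
    (univ.filter fun r => (r.1 ∈ S i ∧ M q r) ∧ (r.1 = u ∨ (M r (u, y) ∧ u ∉ S i))).card ≤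
      K + 1 := by
  set F := univ.filter fun r => (r.1 ∈ S i ∧ M q r) ∧ (r.1 = u ∨ (M r (u, y) ∧ u ∉ S i))
  have hinj : Set.InjOn Prod.fst (F : Set (V × α)) := fun r hr r' hr' h =>
    hS.matching (mem_filter.1 hr).2.1.2 (mem_filter.1 hr').2.1.2 h
  rw [← card_image_of_injOn hinj]
  have hsub : F.image Prod.fst ⊆ insert u
      ((univ.filter fun j => u ∈ S j ∧ u ∉ S i).biUnion fun j => S i ∩ S j) := by
    intro z hz
    obtain ⟨r, hr, rfl⟩ := mem_image.1 hz
    obtain ⟨-, ⟨hri, -⟩, h⟩ := mem_filter.1 hr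
    rcases h with h | ⟨h, hu⟩
    · simp [h]
    · obtain ⟨j, hj, hj'⟩ := hS.exists_common h
      simp only [mem_insert, mem_biUnion, mem_filter, mem_univ, true_and, mem_inter]
      exact Or.inr ⟨j, ⟨hj', hu⟩, hri, hj⟩
  refine (card_le_card hsub).trans ((card_insert_le _ _).trans (Nat.succ_le_succ ?_))
  refine (card_biUnion_le_card_mul _ _ 1 fun j hj => ?_).trans ?_
  · obtain ⟨-, hj, hi⟩ := mem_filter.1 hj
    exact hS.nearlyDisjoint fun hij => hi (hij ▸ hj)
  · rw [mul_one]
    exact (card_le_card fun j hj => mem_filter.2 ⟨mem_univ j, (mem_filter.1 hj).2.1⟩).trans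
      (hS.card_le u)

lemma abs_idleWeight_update_sub_le (hW : ∀ q, 0 ≤ W q) (hWb : ∀ q, W q ≤ b) (T : Finset V)
    (q : V × α) (ω : V → Option α) (u : V) (y : α) :
    |idleWeight M W T q (Function.update ω u (some y)) -
      idleWeight M W T q (Function.update ω u none)| ≤
      b * (univ.filter fun r => (r.1 ∈ T ∧ M q r) ∧ (r.1 = u ∨ (M r (u, y) ∧ u ∉ T))).card := by
  simp only [idleWeight, ← sum_sub_distrib, ← mul_sub]
  have hc : ((univ.filter fun r => (r.1 ∈ T ∧ M q r) ∧ (r.1 = u ∨ (M r (u, y) ∧ u ∉ T))).card : ℝ)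
      = ∑ r with r.1 ∈ T ∧ M q r, if r.1 = u ∨ (M r (u, y) ∧ u ∉ T) then 1 else 0 := by
    rw [← filter_filter, card_filter]
    push_cast
    rfl
  rw [hc, mul_sum]
  refine le_trans (abs_sum_le_sum_abs _ _) (sum_le_sum fun r _ => ?_)
  rw [abs_mul, abs_of_nonneg (hW r)]
  by_cases h : r.1 = u ∨ (M r (u, y) ∧ u ∉ T)
  · rw [if_pos h]
    refine mul_le_mul (hWb r) ?_ (abs_nonneg _) ((hW r).trans (hWb r))
    split_ifs <;> simp
  · rw [if_neg h]
    push Not at h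
    have : IsIdle M T r (Function.update ω u (some y)) ↔
        IsIdle M T r (Function.update ω u none) := by
      simp only [IsIdle, Function.update_of_ne h.1]
      refine and_congr_right fun _ => forall_congr' fun r' => ?_
      by_cases hr' : r'.1 = u
      · subst hr'
        simp only [Function.update_self]
        refine ⟨fun _ _ _ => nofun, fun _ hM hT hy => hT (h.2 ?_)⟩
        rwa [Option.some.inj hy]
      · rw [Function.update_of_ne hr', Function.update_of_ne hr']
    simp [this]

lemma IsSystem.prob_idleWeight_le (hS : IsSystem S L M K Λ D)
    (hw : IsWeighting S M w U ρ b) (hp : 0 ≤ p) (hp1 : p ≤ 1) (hρ : 0 ≤ ρ) (hpK : p * (K * ρ) ≤ 1)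
    {i : ι} {v : V} (hv : v ∈ S i) (c : α) {B l t : ℝ} (hl : 0 ≤ l)
    (hWB : ∀ q, w q * Real.exp (p * totalWeight M w q) ≤ B) (hB : 0 ≤ B)
    (hlB : l * (B * (K + 1)) ≤ 1) :
    prob (activation p w) (fun ω => ρ * (Real.exp (p * ρ) * (1 - p)) + t <
      idleWeight M (fun q => w q * Real.exp (p * totalWeight M w q)) (S i) (v, c) ω) ≤
      Real.exp (l ^ 2 * (2 * B ^ 2 * (K + 1) * D) - l * t) := by
  have hμ := hw.isProb hp hp1
  set n : V → α → ℕ := fun u y => (univ.filter fun r => (r.1 ∈ S i ∧ M (v, c) r) ∧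
    (r.1 = u ∨ (M r (u, y) ∧ u ∉ S i))).card with hn
  have hnK : ∀ u y, (n u y : ℝ) ≤ K + 1 := fun u y => by
    exact_mod_cast hS.card_influence_le i (v, c) u y
  set h : V → Option α → ℝ := fun u x => x.elim 0 fun y => B * n u y with hh
  have h0 : ∀ u x, 0 ≤ h u x := by
    rintro u (_ | y)
    · simp [hh]
    · exact mul_nonneg hB (Nat.cast_nonneg _)
  refine prob_gt_le_of_influence hμ none hl (h := h) ?_ ?_ (hS.expect_idleWeight_le hw hp hp1 hv c)
    ?_
  · rintro u (_ | y)
    · simp [hh]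
    · refine le_trans (mul_le_mul_of_nonneg_left ?_ hl) hlB
      exact mul_le_mul_of_nonneg_left (hnK u y) hB
  · rintro ω u (_ | y)
    · simpa using h0 u none
    · exact abs_idleWeight_update_sub_le
        (fun q => mul_nonneg (hw.nonneg q) (Real.exp_nonneg _)) hWB _ _ _ _ _
  · calc ∑ u, ∑ x, activation p w u x * h u x ^ 2
        ≤ ∑ u, ∑ y, B ^ 2 * (K + 1) * (p * w (u, y) * n u y) := by
          refine sum_le_sum fun u _ => ?_
          rw [Fintype.sum_option]
          simp only [hh, Option.elim, activation_some]
          rw [zero_pow two_ne_zero, mul_zero, zero_add]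
          refine sum_le_sum fun y _ => ?_
          have h1 : 0 ≤ p * w (u, y) * n u y * B ^ 2 := by
            have := hw.nonneg (u, y)
            positivity
          nlinarith [hnK u y]
      _ = B ^ 2 * (K + 1) * ∑ r with r.1 ∈ S i ∧ M (v, c) r, ∑ u, ∑ y,
          p * w (u, y) * if r.1 = u ∨ (M r (u, y) ∧ u ∉ S i) then 1 else 0 := by
          simp only [← mul_sum]
          congr 1
          symm
          rw [sum_comm]
          refine sum_congr rfl fun u _ => ?_
          rw [sum_comm]
          refine sum_congr rfl fun y _ => ?_
          rw [← mul_sum, hn]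
          congr 1
          simp only [← filter_filter, card_filter]
          push_cast
          rfl
      _ ≤ B ^ 2 * (K + 1) * ∑ r with r.1 ∈ S i ∧ M (v, c) r, 2 := by
          gcongr with r hr
          calc _ ≤ ∑ u, ∑ y, ((if r.1 = u then p * w (u, y) else 0) +
                p * if M r (u, y) then w (u, y) else 0) := by
                refine sum_le_sum fun u _ => sum_le_sum fun y _ => ?_
                have := mul_nonneg hp (hw.nonneg (u, y))
                by_cases h1 : r.1 = u <;> by_cases h2 : M r (u, y) <;> by_cases h3 : u ∈ S i <;>
                  simp [h1, h2, h3, this]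
            _ = p * ∑ y, w (r.1, y) + p * totalWeight M w r := by
                simp only [sum_add_distrib, ← mul_sum]
                congr 1
                · rw [sum_comm]
                  simp [mul_sum]
                · rw [totalWeight, sum_filter, Fintype.sum_prod_type]
            _ ≤ 2 := by
                have h1 := hw.sum_le_one r.1
                have h2 := mul_le_mul_of_nonneg_left (hS.totalWeight_le hw hρ r) hp
                nlinarith
      _ ≤ B ^ 2 * (K + 1) * (D * 2) := by
          rw [sum_const, nsmul_eq_mul]
          gcongr
          exact hS.degree_le i v hv c
      _ = _ := by ring

end Idle

section Fail

open scoped Classical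

variable {V α ι : Type*} {S : ι → Finset V} {L : V → Finset α} {M : V × α → V × α → Prop}
  {K Λ D : ℕ}
  {w W : V × α → ℝ} {U : Finset V} {ρ b p : ℝ}

/-- A vertex of smaller rank than that of `q` has a tentative color in conflict with `q`. -/
def IsHitBefore (M : V × α → V × α → Prop) (rank : V → ℕ) (q : V × α) (ω : V → Option α) : Prop :=
  ∃ r, M q r ∧ rank r.1 < rank q.1 ∧ ω r.1 = some r.2

lemma isHitBefore_congr {rank : V → ℕ} {q : V × α} {ω ω' : V → Option α}
    (h : ∀ u, rank u < rank q.1 → ω u = ω' u) :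
    IsHitBefore M rank q ω ↔ IsHitBefore M rank q ω' :=
  exists_congr fun r => and_congr_right fun _ => and_congr_right fun hr => by rw [h r.1 hr]

variable [Fintype α]

/-- The vertex `u` is activated with a tentative color that is in conflict with an earlier one,
although the total weight of such colors is at most `τ`. -/
def Fails (M : V × α → V × α → Prop) (w : V × α → ℝ) (rank : V → ℕ) (τ : ℝ) (u : V)
    (ω : V → Option α) : Prop :=
  (∃ c, ω u = some c ∧ IsHitBefore M rank (u, c) ω) ∧
    ∑ c, w (u, c) * (if IsHitBefore M rank (u, c) ω then 1 else 0) ≤ τ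

lemma dependsOn_fails (rank : V → ℕ) (τ : ℝ) (u : V) :
    DependsOn (Fails M w rank τ u) {v | rank v ≤ rank u} := by
  intro ω ω' h
  have h1 : ∀ c, IsHitBefore M rank (u, c) ω ↔ IsHitBefore M rank (u, c) ω' := fun c =>
    isHitBefore_congr fun v hv => h v (le_of_lt hv)
  simp only [Fails, h1, h u (le_refl (rank u))]

lemma sum_activation_fails_le (hp : 0 ≤ p) {τ : ℝ} (hτ : 0 ≤ τ)
    (rank : V → ℕ) (u : V) (ω : V → Option α) :
    (∑ x, activation p w u x * if Fails M w rank τ u (Function.update ω u x) then 1 else 0) ≤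
      p * τ := by
  have h1 : ∀ c x, IsHitBefore M rank (u, c) (Function.update ω u x) ↔
      IsHitBefore M rank (u, c) ω := fun c x =>
    isHitBefore_congr fun v hv =>
      Function.update_of_ne (fun h => by subst h; exact lt_irrefl _ hv) _ _
  rw [Fintype.sum_option]
  simp only [Fails, h1, Function.update_self, activation_some]
  by_cases hle : ∑ c, w (u, c) * (if IsHitBefore M rank (u, c) ω then 1 else 0) ≤ τ
  · calc _ = p * ∑ c, w (u, c) * (if IsHitBefore M rank (u, c) ω then 1 else 0) := by
          rw [mul_sum]
          simp only [hle, and_true]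
          simp
      _ ≤ p * τ := by gcongr
  · simp only [hle, and_false, if_false, mul_zero, sum_const_zero, add_zero]
    positivity

variable [Fintype V] [Fintype ι]

/-- The total weight of the pairs within `T` in conflict with `q` whose vertex fails. -/
noncomputable def failWeight (M : V × α → V × α → Prop) (w W : V × α → ℝ) (rank : V → ℕ) (τ : ℝ)
    (T : Finset V) (q : V × α) (ω : V → Option α) : ℝ :=
  ∑ u, (∑ x, if u ∈ T ∧ M q (u, x) then W (u, x) else 0) *
    if Fails M w rank τ u ω then 1 else 0

lemma IsSystem.prob_failWeight_le (hS : IsSystem S L M K Λ D)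
    (hμ : IsProb (activation p w)) (hW : ∀ q, 0 ≤ W q) (hp : 0 ≤ p)
    {rank : V → ℕ} (hrank : Function.Injective rank) {τ l B a t : ℝ} (hτ : 0 ≤ τ) (hl : 0 ≤ l)
    (hB : 0 ≤ B) (hWB : ∀ q, W q ≤ B) (hlB : l * B ≤ 1) {T : Finset V} {q : V × α}
    (ha : ∑ r with r.1 ∈ T ∧ M q r, W r ≤ a) :
    prob (activation p w) (fun ω => 2 * p * τ * a + t < failWeight M w W rank τ T q ω) ≤
      Real.exp (-(l * t)) := by
  have h0 : ∀ u, 0 ≤ ∑ x, if u ∈ T ∧ M q (u, x) then W (u, x) else 0 := fun u =>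
    sum_nonneg fun x _ => by split_ifs; exacts [hW _, le_rfl]
  have hle : ∀ u, (∑ x, if u ∈ T ∧ M q (u, x) then W (u, x) else 0) ≤ B := by
    intro u
    rw [← sum_filter]
    rcases (univ.filter fun x => u ∈ T ∧ M q (u, x)).eq_empty_or_nonempty with he | ⟨c, hc⟩
    · simpa [he] using hB
    · rw [eq_singleton_iff_unique_mem.2 ⟨hc, fun c' hc' => ?_⟩]
      · simpa using hWB _
      · exact (Prod.ext_iff.1 (hS.matching (mem_filter.1 hc').2.2 (mem_filter.1 hc).2.2 rfl)).2
  have hs : ∑ u, (∑ x, if u ∈ T ∧ M q (u, x) then W (u, x) else 0) =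
      ∑ r with r.1 ∈ T ∧ M q r, W r := by
    rw [sum_filter, Fintype.sum_prod_type]
  rw [← zero_sub]
  refine prob_gt_le hμ hl ((expect_exp_sequential_le hμ hrank (dependsOn_fails rank τ) hl
    (sum_activation_fails_le hp hτ rank) h0 (fun u => ?_) univ).trans ?_)
  · exact (mul_le_mul_of_nonneg_left (hle u) hl).trans hlB
  · rw [hs, Real.exp_le_exp]
    nlinarith [mul_le_mul_of_nonneg_left ha (show 0 ≤ 2 * l * (p * τ) by positivity)]

end Fail

section Step

open scoped Classical

variable {V α ι : Type*} {S : ι → Finset V} {L : V → Finset α} {M : V × α → V × α → Prop}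
  {K Λ D : ℕ}
  {w W : V × α → ℝ} {U : Finset V} {ρ b p : ℝ}

/-- The pair `q` is in conflict with a tentative color. -/
def IsHit (M : V × α → V × α → Prop) (q : V × α) (ω : V → Option α) : Prop :=
  ∃ r, M q r ∧ ω r.1 = some r.2

lemma IsHitBefore.isHit {rank : V → ℕ} {q : V × α} {ω : V → Option α}
    (h : IsHitBefore M rank q ω) : IsHit M q ω :=
  let ⟨r, hr, _, hω⟩ := h
  ⟨r, hr, hω⟩

variable [Fintype V] [Fintype α] [Fintype ι]

lemma sum_mul_isHit_le (hW : ∀ q, 0 ≤ W q) (v : V) (ω : V → Option α) :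
    ∑ c, W (v, c) * (if IsHit M (v, c) ω then 1 else 0) ≤ hitWeight M W v ω := by
  refine sum_le_sum fun c _ => mul_le_mul_of_nonneg_left ?_ (hW _)
  have h0 : ∀ r : V × α, (0 : ℝ) ≤ if ω r.1 = some r.2 then 1 else 0 := fun r => by positivity
  split_ifs with h
  · obtain ⟨r, hr, hω⟩ := h
    refine le_trans ?_ (single_le_sum (fun r _ => h0 r) (mem_filter.2 ⟨mem_univ r, hr⟩))
    simp [hω]
  · exact sum_nonneg fun r _ => h0 r

/-- The uncolored vertices that are inactive, or whose tentative color is in conflict with an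
earlier one. -/
noncomputable def remaining (M : V × α → V × α → Prop) (U : Finset V) (rank : V → ℕ)
    (ω : V → Option α) : Finset V :=
  U.filter fun v => ω v = none ∨ ∃ c, ω v = some c ∧ IsHitBefore M rank (v, c) ω

lemma IsSystem.isColorable_of_remaining (hS : IsSystem S L M K Λ D) {rank : V → ℕ}
    (hrank : Function.Injective rank) {ω : V → Option α}
    (hω : ∀ v c, ω v = some c → w (v, c) ≠ 0) {w' : V × α → ℝ}
    (hw' : ∀ q, w' q ≠ 0 → w q ≠ 0 ∧ ¬ IsHit M q ω)
    (h : IsColorable M w' (remaining M U rank ω)) : IsColorable M w U := by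
  obtain ⟨φ, hφ, hφM⟩ := h
  set U' := remaining M U rank ω with hU'
  have hout : ∀ v ∈ U, v ∉ U' → ∃ c, ω v = some c ∧ ¬ IsHitBefore M rank (v, c) ω := by
    intro v hv hv'
    have h1 : ¬ (ω v = none ∨ ∃ c, ω v = some c ∧ IsHitBefore M rank (v, c) ω) :=
      fun h => hv' (mem_filter.2 ⟨hv, h⟩)
    push Not at h1
    obtain ⟨c, hc⟩ := Option.ne_none_iff_exists'.1 h1.1
    exact ⟨c, hc, h1.2 c hc⟩
  have hdef : ∀ v c, v ∉ U' → ω v = some c →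
      (if v ∈ U' then φ v else (ω v).getD (φ v)) = c := fun v c hv hc => by simp [hv, hc]
  have hdef' : ∀ v, v ∈ U' → (if v ∈ U' then φ v else (ω v).getD (φ v)) = φ v :=
    fun v hv => if_pos hv
  refine ⟨fun v => if v ∈ U' then φ v else (ω v).getD (φ v), fun v hv => ?_,
    fun u hu v hv hM => ?_⟩
  · by_cases hv' : v ∈ U'
    · simp only [hdef' v hv']
      exact (hw' _ (hφ v hv')).1
    · obtain ⟨c, hc, -⟩ := hout v hv hv'
      simp only [hdef v c hv' hc]
      exact hω v c hc
  · by_cases hu' : u ∈ U' <;> by_cases hv' : v ∈ U'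
    · simp only [hdef' u hu', hdef' v hv'] at hM
      exact hφM u hu' v hv' hM
    · obtain ⟨c, hc, -⟩ := hout v hv hv'
      simp only [hdef' u hu', hdef v c hv' hc] at hM
      exact (hw' _ (hφ u hu')).2 ⟨_, hM, hc⟩
    · obtain ⟨c, hc, -⟩ := hout u hu hu'
      simp only [hdef' v hv', hdef u c hu' hc] at hM
      exact (hw' _ (hφ v hv')).2 ⟨_, hS.symm hM, hc⟩
    · obtain ⟨c, hc, hcn⟩ := hout u hu hu'
      obtain ⟨d, hd, hdn⟩ := hout v hv hv'
      simp only [hdef u c hu' hc, hdef v d hv' hd] at hM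
      rcases lt_trichotomy (rank u) (rank v) with h | h | h
      · exact hdn ⟨_, hS.symm hM, h, hc⟩
      · exact hS.irrefl hM (hrank h)
      · exact hcn ⟨_, hM, h, hd⟩

/-- The weights after one round, before normalization. -/
noncomputable def survivingWeight (M : V × α → V × α → Prop) (W : V × α → ℝ) (U' : Finset V)
    (ω : V → Option α) (q : V × α) : ℝ :=
  if q.1 ∈ U' ∧ ¬ IsHit M q ω then W q else 0

lemma sum_survivingWeight_le (hwW : ∀ q, w q ≤ W q) (hW : ∀ q, 0 ≤ W q) {rank : V → ℕ}
    {ω : V → Option α} {τ : ℝ} (hτ : ∀ v, hitWeight M W v ω ≤ τ) (T : Finset V) (q : V × α) :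
    ∑ r with r.1 ∈ T ∧ M q r, survivingWeight M W (remaining M U rank ω) ω r ≤
      idleWeight M W T q ω + failWeight M w W rank τ T q ω := by
  have hfail : failWeight M w W rank τ T q ω =
      ∑ r with r.1 ∈ T ∧ M q r, W r * if Fails M w rank τ r.1 ω then 1 else 0 := by
    rw [failWeight, sum_filter, Fintype.sum_prod_type]
    simp only [sum_mul, ite_mul, zero_mul]
  rw [hfail, idleWeight, ← sum_add_distrib]
  refine sum_le_sum fun r _ => ?_
  have h1 : 0 ≤ W r * if IsIdle M T r ω then 1 else 0 := mul_nonneg (hW r) (by positivity)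
  have h2 : 0 ≤ W r * if Fails M w rank τ r.1 ω then 1 else 0 :=
    mul_nonneg (hW r) (by positivity)
  rw [survivingWeight]
  by_cases h : r.1 ∈ remaining M U rank ω ∧ ¬ IsHit M r ω
  · rw [if_pos h]
    obtain ⟨hr, hhit⟩ := h
    rcases (mem_filter.1 hr).2 with hn | hf
    · have : IsIdle M T r ω := ⟨hn, fun r' hr' _ h => hhit ⟨r', hr', h⟩⟩
      rw [if_pos this] at h1 ⊢
      linarith
    · have : Fails M w rank τ r.1 ω := by
        refine ⟨hf, le_trans ?_ ((sum_mul_isHit_le hW r.1 ω).trans (hτ r.1))⟩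
        refine sum_le_sum fun c _ => ?_
        have h3 := hW (r.1, c)
        by_cases hb : IsHitBefore M rank (r.1, c) ω
        · simpa [hb, hb.isHit] using hwW _
        · rw [if_neg hb, mul_zero]
          exact mul_nonneg h3 (by positivity)
      rw [if_pos this] at h2 ⊢
      linarith
  · rw [if_neg h]
    positivity

lemma IsSystem.exists_isWeighting_of_outcome (hS : IsSystem S L M K Λ D) {rank : V → ℕ}
    (hrank : Function.Injective rank) {ω : V → Option α}
    (hω : ∀ v c, ω v = some c → w (v, c) ≠ 0) (hwW : ∀ q, w q ≤ W q) (hW : ∀ q, 0 ≤ W q)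
    (hWw : ∀ q, W q ≠ 0 → w q ≠ 0) {b τ s x : ℝ} (hWb : ∀ q, W q ≤ b) (hs : 0 < s)
    (hτ : ∀ v, hitWeight M W v ω ≤ τ) (hsum : ∀ v ∈ U, s ≤ ∑ c, W (v, c) - hitWeight M W v ω)
    (hx : ∀ i, ∀ v ∈ S i, ∀ c, idleWeight M W (S i) (v, c) ω +
      failWeight M w W rank τ (S i) (v, c) ω ≤ x) :
    ∃ w' U', IsWeighting S M w' U' (x / s) (b / s) ∧ (IsColorable M w' U' → IsColorable M w U) := by
  set U' := remaining M U rank ω with hU'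
  set f := survivingWeight M W U' ω with hf
  have hf0 : ∀ q, 0 ≤ f q := fun q => by
    simp only [hf, survivingWeight]
    split_ifs
    exacts [hW q, le_rfl]
  have hfW : ∀ q, f q ≤ W q := fun q => by
    simp only [hf, survivingWeight]
    split_ifs
    exacts [le_rfl, hW q]
  have hσ : ∀ v ∈ U', s ≤ ∑ c, f (v, c) := by
    intro v hv
    refine (hsum v (mem_filter.1 hv).1).trans ?_
    have h1 : ∀ c, f (v, c) = W (v, c) - W (v, c) * if IsHit M (v, c) ω then 1 else 0 := by
      intro c
      simp only [hf, survivingWeight, hv, true_and]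
      split_ifs <;> simp
    simp only [h1, sum_sub_distrib]
    linarith [sum_mul_isHit_le (M := M) hW v ω]
  have hf_out : ∀ v ∉ U', ∀ c, f (v, c) = 0 := fun v hv c => if_neg fun h => hv h.1
  have hfs : ∀ q, f q / ∑ c, f (q.1, c) ≤ f q / s := by
    intro q
    by_cases hq : q.1 ∈ U'
    · exact div_le_div_of_nonneg_left (hf0 q) hs (hσ q.1 hq)
    · simp [hf_out q.1 hq]
  refine ⟨fun q => f q / ∑ c, f (q.1, c), U', ⟨fun q => ?_, fun q => ?_, fun v hv => ?_,
    fun v hv c => ?_, fun i v hv c => ?_⟩, hS.isColorable_of_remaining hrank hω fun q hq => ?_⟩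
  · exact div_nonneg (hf0 q) (sum_nonneg fun c _ => hf0 _)
  · exact (hfs q).trans (by have := (hfW q).trans (hWb q); gcongr)
  · dsimp only
    rw [← sum_div, div_self (hs.trans_le (hσ v hv)).ne']
  · simp [hf_out v hv c]
  · refine (sum_le_sum fun r _ => hfs r).trans ?_
    rw [← sum_div]
    have := (sum_survivingWeight_le (U := U) hwW hW hτ (S i) (v, c)).trans (hx i v hv c)
    gcongr
  · have h1 : f q ≠ 0 := fun h => hq (by simp [h])
    have h2 : q.1 ∈ U' ∧ ¬ IsHit M q ω := by
      by_contra h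
      exact h1 (if_neg h)
    have h3 : f q = W q := if_pos h2
    exact ⟨hWw q (h3 ▸ h1), h2.2⟩

end Step

section Local

open scoped Classical

variable {V α ι : Type*} [Fintype V] [Fintype α] [Fintype ι]
  {S : ι → Finset V} {L : V → Finset α} {M : V × α → V × α → Prop} {K Λ D : ℕ}
  {w W : V × α → ℝ} {ω ω' : V → Option α}

/-- The closed neighborhood of `v` in the graph of conflicts. -/
noncomputable def closedNeighborhood (M : V × α → V × α → Prop) (v : V) : Finset V :=
  univ.filter fun u => u = v ∨ ∃ c x, M (v, c) (u, x)

/-- The ball of radius two around `v` in the graph of conflicts. -/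
noncomputable def secondNeighborhood (M : V × α → V × α → Prop) (v : V) : Finset V :=
  (closedNeighborhood M v).biUnion (closedNeighborhood M)

lemma self_mem_closedNeighborhood (v : V) : v ∈ closedNeighborhood M v :=
  mem_filter.2 ⟨mem_univ v, Or.inl rfl⟩

lemma mem_closedNeighborhood_of_rel {q r : V × α} (h : M q r) :
    r.1 ∈ closedNeighborhood M q.1 :=
  mem_filter.2 ⟨mem_univ _, Or.inr ⟨q.2, r.2, h⟩⟩

lemma closedNeighborhood_subset {u v : V} (h : u ∈ closedNeighborhood M v) :
    closedNeighborhood M u ⊆ secondNeighborhood M v :=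
  subset_biUnion_of_mem (closedNeighborhood M) h

lemma IsSystem.mem_closedNeighborhood_comm (hS : IsSystem S L M K Λ D) {u v : V}
    (h : u ∈ closedNeighborhood M v) : v ∈ closedNeighborhood M u := by
  rcases (mem_filter.1 h).2 with rfl | ⟨c, x, h⟩
  · exact self_mem_closedNeighborhood _
  · exact mem_closedNeighborhood_of_rel (hS.symm h)

lemma IsSystem.mem_secondNeighborhood_comm (hS : IsSystem S L M K Λ D) {u v : V}
    (h : u ∈ secondNeighborhood M v) : v ∈ secondNeighborhood M u := by
  obtain ⟨z, hz, hu⟩ := mem_biUnion.1 h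
  exact mem_biUnion.2
    ⟨z, hS.mem_closedNeighborhood_comm hu, hS.mem_closedNeighborhood_comm hz⟩

lemma IsSystem.card_closedNeighborhood_le (hS : IsSystem S L M K Λ D) (v : V) :
    (closedNeighborhood M v).card ≤ Λ * D * (K * D) + 1 := by
  have hq : ∀ q : V × α, (univ.filter fun r => M q r).card ≤ K * D := by
    intro q
    have := hS.sum_le (f := fun _ => 1) (fun _ => zero_le_one) (a := D) (Nat.cast_nonneg D)
      (fun i v hv c => by simpa using hS.degree_le i v hv c) q
    simp only [sum_const, nsmul_eq_mul, mul_one] at this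
    exact_mod_cast this
  have hsub : closedNeighborhood M v ⊆
      insert v ((L v).biUnion fun c => (univ.filter fun r => M (v, c) r).image Prod.fst) := by
    intro u hu
    rcases (mem_filter.1 hu).2 with rfl | ⟨c, x, h⟩
    · exact mem_insert_self _ _
    · exact mem_insert_of_mem (mem_biUnion.2
        ⟨c, hS.mem_list h, mem_image.2 ⟨(u, x), mem_filter.2 ⟨mem_univ _, h⟩, rfl⟩⟩)
  refine (card_le_card hsub).trans ((card_insert_le _ _).trans (Nat.succ_le_succ ?_))
  refine (card_biUnion_le_card_mul _ _ (K * D) fun c _ => card_image_le.trans (hq _)).trans ?_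
  exact Nat.mul_le_mul_right _ (hS.card_list v)

lemma IsSystem.card_not_disjoint_le (hS : IsSystem S L M K Λ D) (v : V) :
    (univ.filter fun u => ¬ Disjoint (secondNeighborhood M v) (secondNeighborhood M u)).card ≤
      (Λ * D * (K * D) + 1) ^ 4 := by
  have h2 : ∀ v, (secondNeighborhood M v).card ≤ (Λ * D * (K * D) + 1) ^ 2 := fun v => by
    rw [sq]
    exact (card_biUnion_le_card_mul _ _ _ fun u _ => hS.card_closedNeighborhood_le u).trans
      (Nat.mul_le_mul_right _ (hS.card_closedNeighborhood_le v))
  have hsub : (univ.filter fun u =>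
      ¬ Disjoint (secondNeighborhood M v) (secondNeighborhood M u)) ⊆
      (secondNeighborhood M v).biUnion (secondNeighborhood M) := by
    intro u hu
    obtain ⟨z, hz, hzu⟩ := not_disjoint_iff.1 (mem_filter.1 hu).2
    exact mem_biUnion.2 ⟨z, hz, hS.mem_secondNeighborhood_comm hzu⟩
  refine (card_le_card hsub).trans
    ((card_biUnion_le_card_mul _ _ _ fun u _ => h2 u).trans ?_)
  calc _ ≤ (Λ * D * (K * D) + 1) ^ 2 * (Λ * D * (K * D) + 1) ^ 2 := Nat.mul_le_mul_right _ (h2 v)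
    _ = _ := by ring

lemma hitWeight_congr {v : V} (h : ∀ u ∈ closedNeighborhood M v, ω u = ω' u) :
    hitWeight M W v ω = hitWeight M W v ω' := by
  refine sum_congr rfl fun c _ => ?_
  congr 1
  refine sum_congr rfl fun r hr => ?_
  rw [h r.1 (mem_closedNeighborhood_of_rel (mem_filter.1 hr).2)]

lemma isIdle_congr {T : Finset V} {q : V × α}
    (h : ∀ u ∈ closedNeighborhood M q.1, ω u = ω' u) : IsIdle M T q ω ↔ IsIdle M T q ω' := by
  rw [IsIdle, IsIdle, h q.1 (self_mem_closedNeighborhood _)]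
  refine and_congr_right fun _ => forall_congr' fun r => forall_congr' fun hr => ?_
  rw [h r.1 (mem_closedNeighborhood_of_rel hr)]

lemma fails_congr {rank : V → ℕ} {τ : ℝ} {u : V}
    (h : ∀ z ∈ closedNeighborhood M u, ω z = ω' z) :
    Fails M w rank τ u ω ↔ Fails M w rank τ u ω' := by
  have h1 : ∀ c, IsHitBefore M rank (u, c) ω ↔ IsHitBefore M rank (u, c) ω' := fun c =>
    exists_congr fun r => and_congr_right fun hr => and_congr_right fun _ => by
      rw [h r.1 (mem_closedNeighborhood_of_rel hr)]
  simp only [Fails, h1, h u (self_mem_closedNeighborhood _)]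

lemma idleWeight_congr {T : Finset V} {q : V × α}
    (h : ∀ u ∈ secondNeighborhood M q.1, ω u = ω' u) :
    idleWeight M W T q ω = idleWeight M W T q ω' := by
  refine sum_congr rfl fun r hr => ?_
  have := closedNeighborhood_subset (mem_closedNeighborhood_of_rel (mem_filter.1 hr).2.2)
  rw [isIdle_congr fun u hu => h u (this hu)]

lemma failWeight_congr {rank : V → ℕ} {τ : ℝ} {T : Finset V} {q : V × α}
    (h : ∀ u ∈ secondNeighborhood M q.1, ω u = ω' u) :
    failWeight M w W rank τ T q ω = failWeight M w W rank τ T q ω' := by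
  refine sum_congr rfl fun u _ => ?_
  by_cases hu : ∃ x, M q (u, x)
  · obtain ⟨x, hx⟩ := hu
    have := closedNeighborhood_subset (mem_closedNeighborhood_of_rel hx)
    rw [fails_congr fun z hz => h z (this hz)]
  · push Not at hu
    simp [hu]

end Local

section Bad

open scoped Classical

variable {V α ι : Type*} [Fintype V] [Fintype α] [Fintype ι]
  {S : ι → Finset V} {L : V → Finset α} {M : V × α → V × α → Prop} {K Λ D : ℕ}
  {w W : V × α → ℝ} {rank : V → ℕ} {τ x y : ℝ} {a : V → ℝ}

/-- Some quantity around `v` exceeds its prescribed bound. -/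
def IsBad (S : ι → Finset V) (L : V → Finset α) (M : V × α → V × α → Prop) (w W : V × α → ℝ)
    (rank : V → ℕ) (τ : ℝ) (a : V → ℝ) (x y : ℝ) (v : V) (ω : V → Option α) : Prop :=
  a v < hitWeight M W v ω ∨ ∃ k ∈ (univ.filter fun i => v ∈ S i) ×ˢ L v,
    x < idleWeight M W (S k.1) (v, k.2) ω ∨ y < failWeight M w W rank τ (S k.1) (v, k.2) ω

lemma dependsOn_isBad (v : V) :
    DependsOn (IsBad S L M w W rank τ a x y v) (secondNeighborhood M v) := by
  intro ω ω' h
  have h1 : hitWeight M W v ω = hitWeight M W v ω' := hitWeight_congr fun u hu =>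
    h u (closedNeighborhood_subset (self_mem_closedNeighborhood v) hu)
  have h2 : ∀ T c, idleWeight M W T (v, c) ω = idleWeight M W T (v, c) ω' := fun T c =>
    idleWeight_congr fun u hu => h u hu
  have h3 : ∀ T c, failWeight M w W rank τ T (v, c) ω = failWeight M w W rank τ T (v, c) ω' :=
    fun T c => failWeight_congr fun u hu => h u hu
  simp only [IsBad, h1, h2, h3]

lemma IsSystem.prob_isBad_le (hS : IsSystem S L M K Λ D) {μ : V → Option α → ℝ} (hμ : IsProb μ)
    {v : V} {e : ℝ} (he : 0 ≤ e) (h1 : prob μ (fun ω => a v < hitWeight M W v ω) ≤ e)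
    (h2 : ∀ i, v ∈ S i → ∀ c, prob μ (fun ω => x < idleWeight M W (S i) (v, c) ω) ≤ e)
    (h3 : ∀ i, v ∈ S i → ∀ c,
      prob μ (fun ω => y < failWeight M w W rank τ (S i) (v, c) ω) ≤ e) :
    prob μ (IsBad S L M w W rank τ a x y v) ≤ (1 + K * (Λ * D) * 2) * e := by
  set s := (univ.filter fun i => v ∈ S i) ×ˢ L v with hs
  have hcard : (s.card : ℝ) ≤ K * (Λ * D) := by
    rw [hs, card_product]
    exact_mod_cast Nat.mul_le_mul (hS.card_le v) (hS.card_list v)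
  have h4 : prob μ (fun ω => ∃ k ∈ s, x < idleWeight M W (S k.1) (v, k.2) ω ∨
      y < failWeight M w W rank τ (S k.1) (v, k.2) ω) ≤ s.card * (e + e) := by
    refine (prob_exists_le hμ s _).trans ?_
    rw [← nsmul_eq_mul]
    refine sum_le_card_nsmul _ _ _ fun k hk => (prob_or_le hμ _ _).trans ?_
    have hv := (mem_filter.1 (mem_product.1 hk).1).2
    exact add_le_add (h2 _ hv _) (h3 _ hv _)
  refine (prob_or_le hμ _ _).trans ((add_le_add h1 h4).trans ?_)
  nlinarith

lemma IsSystem.exists_not_isBad (hS : IsSystem S L M K Λ D) {μ : V → Option α → ℝ}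
    (hμ : IsProb μ) {e : ℝ} (he : 0 ≤ e)
    (h : ∀ v, prob μ (IsBad S L M w W rank τ a x y v) ≤ e)
    (h4 : (Λ * D * (K * D) + 1) ^ 4 * e ≤ 1 / 4) :
    ∃ ω, (∀ v, ¬ IsBad S L M w W rank τ a x y v ω) ∧ ∀ v, μ v (ω v) ≠ 0 := by
  refine exists_forall_not hμ _ (secondNeighborhood M) dependsOn_isBad (fun v => ?_) fun v => ?_
  · refine (h v).trans (le_trans ?_ h4)
    have : (1 : ℝ) ≤ (Λ * D * (K * D) + 1) ^ 4 := one_le_pow₀ (by norm_cast; omega)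
    nlinarith
  · refine (sum_le_card_nsmul _ _ e fun u _ => h u).trans (le_trans ?_ h4)
    rw [nsmul_eq_mul]
    gcongr
    exact_mod_cast hS.card_not_disjoint_le v

end Bad

section Round

open scoped Classical
open Filter Topology

lemma exists_pow_mul_exp_le (K Λ : ℕ) {c : ℝ} (hc : 0 < c) :
    ∃ D₀ : ℕ, ∀ D : ℕ, D₀ ≤ D → 1 ≤ D ∧
      ((Λ * D * (K * D) + 1 : ℝ) ^ 4 * ((1 + K * (Λ * D) * 2) * Real.exp (-(c * D))) ≤ 1 / 4) := by
  have h1 : Tendsto (fun D : ℕ => ((Λ * K + 1) ^ 4 * (1 + K * Λ * 2) / c ^ 9 : ℝ) *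
      ((c * D) ^ 9 * Real.exp (-(c * D)))) atTop (𝓝 0) := by
    rw [← mul_zero ((Λ * K + 1) ^ 4 * (1 + K * Λ * 2) / c ^ 9 : ℝ)]
    exact ((Real.tendsto_pow_mul_exp_neg_atTop_nhds_zero 9).comp
      (tendsto_natCast_atTop_atTop.const_mul_atTop hc)).const_mul _
  obtain ⟨D₀, hD₀⟩ := eventually_atTop.1
    ((h1.eventually (ge_mem_nhds (show (0 : ℝ) < 1 / 4 by norm_num))).and
      (eventually_ge_atTop 1))
  refine ⟨D₀, fun D hD => ⟨(hD₀ D hD).2, le_trans ?_ (hD₀ D hD).1⟩⟩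
  have hD1 : (1 : ℝ) ≤ D := by exact_mod_cast (hD₀ D hD).2
  have hD2 : (1 : ℝ) ≤ (D : ℝ) ^ 2 := one_le_pow₀ hD1
  calc _ ≤ ((Λ * K + 1) * (D : ℝ) ^ 2) ^ 4 *
        ((1 + K * Λ * 2) * (D : ℝ) * Real.exp (-(c * D))) := by
        gcongr
        · nlinarith
        · nlinarith
    _ = _ := by
        field_simp

lemma exp_le_two {x : ℝ} (hx : x ≤ 1 / 2) : Real.exp x ≤ 2 := by
  have h1 := Real.add_one_le_exp (-x)
  have h2 : Real.exp x * Real.exp (-x) = 1 := by rw [← Real.exp_add]; simp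
  nlinarith [Real.exp_pos x]

lemma div_one_sub_le {p ρ k x : ℝ} (hp : 0 ≤ p) (hk : 1 ≤ k) (hpk : p * k ≤ 1 / 16) (hρ : 0 ≤ ρ)
    (hρ1 : ρ ≤ 1)
    (hx : x ≤ ρ * (Real.exp (p * ρ) * (1 - p)) + p ^ 2 + (12 * p ^ 2 * k + p ^ 2)) :
    x / (1 - 2 * (k * p) ^ 2) ≤ ρ - p * ρ * (1 - ρ) + 25 * (k * p) ^ 2 := by
  have hpp : p ≤ p * k := by nlinarith
  have hpρ : p * ρ ≤ p := by nlinarith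
  have hpρ0 : 0 ≤ p * ρ := by positivity
  have hexp : Real.exp (p * ρ) ≤ 1 + p * ρ + p ^ 2 := by
    have h1 := Real.abs_exp_sub_one_sub_id_le (x := p * ρ) (by rw [abs_of_nonneg hpρ0]; linarith)
    nlinarith [le_abs_self (Real.exp (p * ρ) - 1 - p * ρ)]
  have h1 : Real.exp (p * ρ) * (1 - p) ≤ 1 - p * (1 - ρ) + p ^ 2 := by
    have : Real.exp (p * ρ) * (1 - p) ≤ (1 + p * ρ + p ^ 2) * (1 - p) := by
      gcongr
      linarith
    nlinarith [mul_nonneg hp hpρ0, mul_nonneg hp (sq_nonneg p)]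
  have h2 : ρ * (Real.exp (p * ρ) * (1 - p)) ≤ ρ - p * ρ * (1 - ρ) + p ^ 2 := by
    have := mul_le_mul_of_nonneg_left h1 hρ
    nlinarith [sq_nonneg p]
  have hkp : p ^ 2 * k ≤ (k * p) ^ 2 := by
    have : 0 ≤ p ^ 2 * k := by positivity
    nlinarith
  have hkp2 : p ^ 2 ≤ (k * p) ^ 2 := by nlinarith
  have ht : (k * p) ^ 2 ≤ 1 / 256 := by nlinarith
  have ht0 : 0 ≤ (k * p) ^ 2 := sq_nonneg _
  have hx1 : x ≤ ρ - p * ρ * (1 - ρ) + 15 * (k * p) ^ 2 := by linarith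
  have hy : ρ - p * ρ * (1 - ρ) ≤ 1 := by nlinarith [mul_nonneg hpρ0 (sub_nonneg.2 hρ1)]
  have hy0 : 0 ≤ ρ - p * ρ * (1 - ρ) := by nlinarith [mul_nonneg hpρ0 hρ]
  rw [div_le_iff₀ (by linarith)]
  nlinarith [mul_nonneg hy0 ht0]

variable {V α ι : Type*} [Fintype V] [Fintype α]
  {S : ι → Finset V} {L : V → Finset α} {M : V × α → V × α → Prop} {K Λ D : ℕ}
  {w W : V × α → ℝ} {U : Finset V} {ρ b p : ℝ}

lemma IsWeighting.mono (hw : IsWeighting S M w U ρ b) {ρ' b' : ℝ} (hρ : ρ ≤ ρ') (hb : b ≤ b') :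
    IsWeighting S M w U ρ' b' :=
  { hw with
    le := fun q => (hw.le q).trans hb
    degree_le := fun i v hv c => (hw.degree_le i v hv c).trans hρ }

variable [Fintype ι]

set_option maxHeartbeats 800000 in
lemma IsSystem.exists_round (hS : IsSystem S L M K Λ D) (hw : IsWeighting S M w U ρ b)
    (hρ : 0 ≤ ρ) (hρ1 : ρ ≤ 1) (hp : 0 < p) (hK : 1 ≤ K) (hpK : p * K ≤ 1 / 16) {B : ℝ}
    (hB : 1 ≤ B) (hD : 1 ≤ D) (hb : b = B / D)
    (hlarge : (Λ * D * (K * D) + 1 : ℝ) ^ 4 * ((1 + K * (Λ * D) * 2) *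
      Real.exp (-(p ^ 2 / (16 * B ^ 2 * (K + 1)) * p ^ 2 / 2 * D))) ≤ 1 / 4) :
    ∃ w' U', IsWeighting S M w' U' (ρ - p * ρ * (1 - ρ) + 25 * (K * p) ^ 2) (4 * B / D) ∧
      (IsColorable M w' U' → IsColorable M w U) := by
  have hK' : (1 : ℝ) ≤ K := by exact_mod_cast hK
  have hD' : (1 : ℝ) ≤ D := by exact_mod_cast hD
  have hpp : p ≤ p * K := by nlinarith
  have hp1 : p ≤ 1 := by linarith
  have hμ := hw.isProb hp.le hp1
  have hb0 : 0 ≤ b := by rw [hb]; positivity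
  have hs0 : ∀ q, 0 ≤ totalWeight M w q := totalWeight_nonneg hw.nonneg
  have hs : ∀ q, p * totalWeight M w q ≤ p * K := fun q =>
    mul_le_mul_of_nonneg_left ((hS.totalWeight_le hw hρ q).trans (by nlinarith)) hp.le
  set W : V × α → ℝ := fun q => w q * Real.exp (p * totalWeight M w q) with hWdef
  have hwW : ∀ q, w q ≤ W q := fun q =>
    le_mul_of_one_le_right (hw.nonneg q) (Real.one_le_exp (mul_nonneg hp.le (hs0 q)))
  have hW2 : ∀ q, W q ≤ 2 * w q := fun q => by
    have := exp_le_two ((hs q).trans (hpK.trans (by norm_num)))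
    have h0 := hw.nonneg q
    simp only [hWdef]
    nlinarith
  have hW : ∀ q, 0 ≤ W q := fun q => (hw.nonneg q).trans (hwW q)
  have hWb : ∀ q, W q ≤ 2 * b := fun q => (hW2 q).trans (by linarith [hw.le q])
  have hWs : ∀ v, ∑ c, W (v, c) ≤ 2 := fun v => by
    calc _ ≤ ∑ c, 2 * w (v, c) := sum_le_sum fun c _ => hW2 _
      _ ≤ 2 := by rw [← mul_sum]; linarith [hw.sum_le_one v]
  have hWd : ∀ i, ∀ v ∈ S i, ∀ c, ∑ r with r.1 ∈ S i ∧ M (v, c) r, W r ≤ 2 := by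
    intro i v hv c
    calc _ ≤ ∑ r with r.1 ∈ S i ∧ M (v, c) r, 2 * w r := sum_le_sum fun c _ => hW2 _
      _ ≤ 2 := by rw [← mul_sum]; linarith [hw.degree_le i v hv c]
  set e : V → ℝ := fun v => ∑ c, W (v, c) * (p * totalWeight M w (v, c)) with he
  have heK : ∀ v, e v ≤ 2 * (p * K) := fun v => by
    calc _ ≤ ∑ c, W (v, c) * (p * K) :=
          sum_le_sum fun c _ => mul_le_mul_of_nonneg_left (hs _) (hW _)
      _ ≤ _ := by rw [← sum_mul]; gcongr; exact hWs v
  set θ : ℝ := p ^ 2 / (16 * B ^ 2 * (K + 1)) with hθ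
  have hθ0 : 0 ≤ θ := by positivity
  have hθ1 : θ * (16 * B ^ 2 * (K + 1)) = p ^ 2 := by
    rw [hθ]; field_simp
  have hlb : ∀ x : ℝ, θ * D * (2 * b * x) = 2 * θ * B * x := fun x => by
    rw [hb]; field_simp
  have hθB : 2 * θ * B * (K + 1) ≤ 1 := by
    have : 0 ≤ θ * (K + 1) := by positivity
    nlinarith [mul_nonneg (mul_nonneg this (zero_le_one.trans hB)) (sub_nonneg.2 hB)]
  have hθB' : 2 * θ * B ≤ 1 := by
    have : 0 ≤ 2 * θ * B := by positivity
    nlinarith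
  set E : ℝ := Real.exp (-(θ * p ^ 2 / 2 * D)) with hE
  set τ : ℝ := 3 * (p * K) with hτ
  have hbad : ∀ v, prob (activation p w) (IsBad S L M w W (Fintype.equivFin V · : V → ℕ) τ
      (fun v => e v + p ^ 2) (ρ * (Real.exp (p * ρ) * (1 - p)) + p ^ 2)
      (2 * p * τ * 2 + p ^ 2) v) ≤ (1 + K * (Λ * D) * 2) * E := by
    intro v
    refine hS.prob_isBad_le hμ (Real.exp_nonneg _) ?_ (fun i hi c => ?_) fun i hi c => ?_
    · refine (hS.prob_hitWeight_le hμ hW (b := 2 * b) (l := θ * D) (by positivity) hWb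
        (by positivity) ?_ le_rfl).trans ?_
      · simpa using (hlb 1).trans_le (by simpa using hθB')
      · rw [Real.exp_le_exp]
        have h1 : (θ * D) ^ 2 * (2 * b * e v) = θ * D * (2 * θ * B * e v) := by
          rw [← hlb]; ring
        have h2 : 2 * θ * B * e v ≤ p ^ 2 / 2 := by
          rw [← hθ1]
          have h3 : 0 ≤ θ * B := by positivity
          have h4 : θ * B ≤ θ * B * (B * (K + 1)) := le_mul_of_one_le_right h3 (by nlinarith)
          nlinarith [mul_le_mul_of_nonneg_left (heK v) h3]
        have h5 : 0 ≤ θ * D := by positivity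
        rw [h1]
        nlinarith [mul_le_mul_of_nonneg_left h2 h5]
    · refine (hS.prob_idleWeight_le hw hp.le hp1 hρ ?_ hi c (B := 2 * b) (l := θ * D)
        (by positivity) hWb (by positivity) ?_).trans ?_
      · nlinarith
      · rw [hlb]; exact hθB
      · rw [Real.exp_le_exp]
        have h1 : θ * D * (2 * b) = 2 * θ * B := by simpa using hlb 1
        have h2 : (θ * D) ^ 2 * (2 * (2 * b) ^ 2 * (K + 1) * D) =
            (θ * D * (2 * b)) ^ 2 * (2 * (K + 1) * D) := by ring
        rw [h2, h1, ← hθ1]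
        exact le_of_eq (by ring)
    · refine (hS.prob_failWeight_le hμ hW hp.le
        (Fin.val_injective.comp (Fintype.equivFin V).injective) (l := θ * D) (by positivity)
        (by positivity) (B := 2 * b) (by positivity) hWb ?_ (hWd i v hi c)).trans ?_
      · simpa using (hlb 1).trans_le (by simpa using hθB')
      · rw [Real.exp_le_exp]
        have : 0 ≤ θ * p ^ 2 * D := by positivity
        nlinarith
  obtain ⟨ω, hω, hωμ⟩ := hS.exists_not_isBad hμ (by positivity) hbad hlarge
  have hgood : ∀ v, hitWeight M W v ω ≤ e v + p ^ 2 := fun v =>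
    not_lt.1 fun h => hω v (Or.inl h)
  have hpos : 0 ≤ ρ * (Real.exp (p * ρ) * (1 - p)) := by
    have : 0 ≤ 1 - p := by linarith
    positivity
  have hKp : (K * p) ^ 2 ≤ 1 / 4 := by
    have : 0 ≤ K * p := by positivity
    nlinarith
  have hσ : 0 < 1 - 2 * (K * p) ^ 2 := by linarith
  have hτ' : ∀ v, hitWeight M W v ω ≤ τ := by
    intro v
    have h1 := hgood v
    have h2 := heK v
    have h3 : p ^ 2 ≤ p * K := by nlinarith
    linarith
  have hsum : ∀ v ∈ U, 1 - 2 * (K * p) ^ 2 ≤ ∑ c, W (v, c) - hitWeight M W v ω := by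
    intro v hv
    have h1 : ∑ c, (W (v, c) - W (v, c) * (p * totalWeight M w (v, c))) ≥
        ∑ c, w (v, c) * (1 - (p * K) ^ 2) := by
      refine sum_le_sum fun c _ => ?_
      have h2 := Real.add_one_le_exp (p * totalWeight M w (v, c))
      have h3 := hs (v, c)
      have h4 : 0 ≤ p * totalWeight M w (v, c) := mul_nonneg hp.le (hs0 _)
      have h5 : 1 - (p * K) ^ 2 ≤ Real.exp (p * totalWeight M w (v, c)) *
          (1 - p * totalWeight M w (v, c)) := by nlinarith
      have := mul_le_mul_of_nonneg_left h5 (hw.nonneg (v, c))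
      simp only [hWdef]
      linarith
    rw [← sum_mul, hw.sum_eq v hv, sum_sub_distrib] at h1
    have := hgood v
    simp only [he] at this
    nlinarith
  have hx : ∀ i, ∀ v ∈ S i, ∀ c, idleWeight M W (S i) (v, c) ω +
      failWeight M w W (Fintype.equivFin V · : V → ℕ) τ (S i) (v, c) ω ≤
      (ρ * (Real.exp (p * ρ) * (1 - p)) + p ^ 2) + (2 * p * τ * 2 + p ^ 2) := by
    intro i v hv c
    by_cases hc : c ∈ L v
    · have hk : (i, c) ∈ (univ.filter fun i => v ∈ S i) ×ˢ L v :=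
        mem_product.2 ⟨mem_filter.2 ⟨mem_univ i, hv⟩, hc⟩
      exact add_le_add (not_lt.1 fun h => hω v (Or.inr ⟨_, hk, Or.inl h⟩))
        (not_lt.1 fun h => hω v (Or.inr ⟨_, hk, Or.inr h⟩))
    · have h1 : ∀ r, ¬ M (v, c) r := fun r h => hc (hS.mem_list h)
      simp only [idleWeight, failWeight, h1, and_false, filter_false, sum_empty, if_false,
        sum_const_zero, zero_mul, add_zero]
      positivity
  obtain ⟨w', U', hw', hcol⟩ := hS.exists_isWeighting_of_outcome
    (Fin.val_injective.comp (Fintype.equivFin V).injective)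
    (fun v c hv h0 => hωμ v (by rw [hv, activation_some, h0, mul_zero])) hwW hW
    (fun q hq h0 => hq (by simp [hWdef, h0])) hWb hσ hτ' hsum hx
  refine ⟨w', U', hw'.mono ?_ ?_, hcol⟩
  · refine div_one_sub_le hp.le hK' hpK hρ hρ1 (le_of_eq ?_)
    rw [hτ]; ring
  · rw [div_le_iff₀ hσ, hb, mul_div_assoc]
    have : 0 ≤ B / D := by positivity
    nlinarith [mul_le_mul_of_nonneg_left hKp this]

end Round

section Terminal

open scoped Classical

variable {V α ι : Type*} [Fintype V] [Fintype α] [Fintype ι]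
  {S : ι → Finset V} {L : V → Finset α} {M : V × α → V × α → Prop} {K Λ D : ℕ}
  {w : V × α → ℝ} {U : Finset V} {ρ b : ℝ}

lemma prob_eq_and_eq {β : Type*} [Fintype β] {μ : V → β → ℝ} (hμ : IsProb μ) {u v : V}
    (huv : u ≠ v) (x y : β) : prob μ (fun ω => ω u = x ∧ ω v = y) = μ u x * μ v y := by
  have h1 : ∀ (z : V) (t : β), DependsOn (fun ω : V → β => if ω z = t then (1 : ℝ) else 0)
      (({z} : Finset V) : Set V) := fun z t ω ω' h => by
    dsimp only
    rw [h z (by simp)]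
  have h2 : ∀ (z : V) (t : β), expect μ (fun ω => if ω z = t then (1 : ℝ) else 0) = μ z t :=
    fun z t => by
      rw [expect_apply hμ z fun s => if s = t then 1 else 0]
      simp
  rw [← h2 u x, ← h2 v y, ← expect_mul hμ (by simpa using huv) (h1 u x) (h1 v y), prob]
  congr 1
  ext ω
  by_cases hu : ω u = x <;> by_cases hv : ω v = y <;> simp [hu, hv]

lemma IsSystem.isColorable_of_small [Nonempty α] (hS : IsSystem S L M K Λ D)
    (hw : IsWeighting S M w U ρ b) (hρ : 0 ≤ ρ) (hK : K * ρ ≤ 1 / 16) : IsColorable M w U := by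
  have hμ : IsProb (activation 1 w) := hw.isProb zero_le_one le_rfl
  set A : (V × α) × (V × α) → (V → Option α) → Prop := fun k ω =>
    M k.1 k.2 ∧ ω k.1.1 = some k.1.2 ∧ ω k.2.1 = some k.2.2 with hA
  set f : (V × α) × (V × α) → ℝ := fun k => if M k.1 k.2 then w k.1 * w k.2 else 0 with hf
  have hf0 : ∀ k, 0 ≤ f k := fun k => by
    simp only [hf]
    split_ifs
    exacts [mul_nonneg (hw.nonneg _) (hw.nonneg _), le_rfl]
  have hAf : ∀ k, prob (activation 1 w) (A k) = f k := by
    intro k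
    by_cases hk : M k.1 k.2
    · simp only [hA, hf, hk, true_and, if_true]
      rw [prob_eq_and_eq hμ (hS.irrefl hk), activation_some, activation_some, one_mul, one_mul]
    · simp [hA, hf, hk, prob, expect_const hμ]
  have h1 : ∀ z, (∑ k, if k.1.1 = z then f k else 0) ≤ K * ρ := by
    intro z
    calc (∑ k, if k.1.1 = z then f k else 0)
        = ∑ c, w (z, c) * totalWeight M w (z, c) := by
          rw [Fintype.sum_prod_type, Fintype.sum_prod_type, sum_eq_single z]
          · simp only [if_true, hf, totalWeight, mul_sum, sum_filter, mul_ite, mul_zero]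
          · intro u _ hu
            simp [hu]
          · simp
      _ ≤ ∑ c, w (z, c) * (K * ρ) := sum_le_sum fun c _ =>
          mul_le_mul_of_nonneg_left (hS.totalWeight_le hw hρ _) (hw.nonneg _)
      _ ≤ 1 * (K * ρ) := by
          rw [← sum_mul]
          gcongr
          exact hw.sum_le_one z
      _ = _ := one_mul _
  have h2 : ∀ z, (∑ k, if k.2.1 = z then f k else 0) ≤ K * ρ := by
    intro z
    refine le_trans (le_of_eq ?_) (h1 z)
    refine Fintype.sum_equiv (Equiv.prodComm _ _) _ _ fun k => ?_
    have : f k.swap = f k := by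
      have hM : M k.2 k.1 ↔ M k.1 k.2 := ⟨hS.symm, hS.symm⟩
      simp only [hf, Prod.fst_swap, Prod.snd_swap, hM, mul_comm]
    simp [this]
  have hdep : ∀ k, DependsOn (A k) (({k.1.1, k.2.1} : Finset V) : Set V) := by
    intro k ω ω' h
    simp only [hA]
    rw [h k.1.1 (by simp), h k.2.1 (by simp)]
  have h4 : ∀ k, prob (activation 1 w) (A k) ≤ 1 / 4 := by
    intro k
    rw [hAf]
    have h3 : f k ≤ ∑ k', if k'.1.1 = k.1.1 then f k' else 0 := by
      refine le_trans ?_ (single_le_sum (fun k' _ => ?_) (mem_univ k))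
      · simp
      · split_ifs
        exacts [hf0 _, le_rfl]
    linarith [h1 k.1.1]
  have hT : ∀ k : (V × α) × (V × α), ∑ l : (V × α) × (V × α)
      with ¬ Disjoint ({k.1.1, k.2.1} : Finset V) {l.1.1, l.2.1},
      prob (activation 1 w) (A l) ≤ 1 / 4 := by
    intro k
    calc _ ≤ ∑ l, (((if l.1.1 = k.1.1 then f l else 0) + if l.2.1 = k.1.1 then f l else 0) +
          ((if l.1.1 = k.2.1 then f l else 0) + if l.2.1 = k.2.1 then f l else 0)) := by
          rw [sum_filter]
          refine sum_le_sum fun l _ => ?_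
          have := hf0 l
          rw [hAf]
          split_ifs with h <;> first | positivity | linarith | skip
          simp_all [eq_comm]
      _ ≤ 1 / 4 := by
          simp only [sum_add_distrib]
          linarith [h1 k.1.1, h1 k.2.1, h2 k.1.1, h2 k.2.1]
  obtain ⟨ω, hω, hω0⟩ := exists_forall_not hμ A (fun k => {k.1.1, k.2.1}) hdep h4 hT
  have hsome : ∀ v ∈ U, ∃ c, ω v = some c := by
    intro v hv
    refine Option.ne_none_iff_exists'.1 fun h => hω0 v ?_
    rw [h, activation_none, hw.sum_eq v hv]
    simp
  obtain ⟨c₀⟩ := ‹Nonempty α›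
  have hφ : ∀ v ∈ U, ω v = some ((ω v).getD c₀) := fun v hv => by
    obtain ⟨c, hc⟩ := hsome v hv
    simp [hc]
  refine ⟨fun v => (ω v).getD c₀, fun v hv h => hω0 v ?_, fun u hu v hv hM =>
    hω ((u, _), (v, _)) ⟨hM, hφ u hu, hφ v hv⟩⟩
  rw [hφ v hv, activation_some, h, mul_zero]

end Terminal

section Iteration

open scoped Classical

lemma IsSystem.isColorable_iteration {K Λ : ℕ} (hK : 1 ≤ K) {p ε ρ₀ : ℝ} (hp : 0 < p)
    (hpK : p * K ≤ 1 / 16) (hε : 0 < ε) (hρ₀ : 0 < ρ₀) (hKρ : K * ρ₀ ≤ 1 / 16)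
    (hpε : 25 * (K * p) ^ 2 ≤ p * (ρ₀ * ε) / 2) (n : ℕ) :
    ∀ B : ℝ, 1 ≤ B → ∃ D₀ : ℕ, ∀ D ≥ D₀, ∀ (V α ι : Type) [Fintype V] [Fintype α] [Fintype ι]
      [Nonempty α] (S : ι → Finset V) (L : V → Finset α) (M : V × α → V × α → Prop)
      (w : V × α → ℝ) (U : Finset V) (ρ : ℝ), IsSystem S L M K Λ D →
      IsWeighting S M w U ρ (B / D) → 0 ≤ ρ → ρ ≤ 1 - ε → ρ ≤ ρ₀ + n * (p * (ρ₀ * ε) / 2) →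
      IsColorable M w U := by
  induction n with
  | zero =>
    refine fun B _ => ⟨0, fun D _ V α ι _ _ _ _ S L M w U ρ hS hw hρ0 _ hρ => ?_⟩
    refine hS.isColorable_of_small hw hρ0 (le_trans ?_ hKρ)
    gcongr
    simpa using hρ
  | succ n ih =>
    intro B hB
    obtain ⟨D₁, hD₁⟩ := ih (4 * B) (by linarith)
    obtain ⟨D₂, hD₂⟩ := exists_pow_mul_exp_le K Λ
      (c := p ^ 2 / (16 * B ^ 2 * (K + 1)) * p ^ 2 / 2) (by positivity)
    refine ⟨max D₁ D₂, fun D hD V α ι _ _ _ _ S L M w U ρ hS hw hρ0 hρ1 hρ => ?_⟩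
    obtain ⟨hD1, hlarge⟩ := hD₂ D (le_trans (le_max_right _ _) hD)
    rcases le_total ρ ρ₀ with h | h
    · refine hS.isColorable_of_small hw hρ0 (le_trans ?_ hKρ)
      gcongr
    · obtain ⟨w', U', hw', hcol⟩ := hS.exists_round hw hρ0 (by linarith) hp hK hpK hB hD1 rfl hlarge
      have h1 : ρ₀ * ε ≤ ρ * (1 - ρ) := by
        have : ε ≤ 1 - ρ := by linarith
        gcongr
      have h2 : p * (ρ₀ * ε) ≤ p * ρ * (1 - ρ) := by
        rw [mul_assoc]
        gcongr
      have h3 : 0 < p * (ρ₀ * ε) := by positivity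
      push_cast at hρ
      refine hcol (hD₁ D (le_trans (le_max_left _ _) hD) V α ι S L M w' U'
        (max 0 (ρ - p * (ρ₀ * ε) / 2)) hS
        (hw'.mono (le_trans ?_ (le_max_right _ _)) le_rfl) (le_max_left _ _)
        (max_le (by linarith) (by linarith)) (max_le (by positivity) (by linarith)))
      linarith

lemma exists_isColorable {K Λ : ℕ} (hK : 1 ≤ K) {ε : ℝ} (hε : 0 < ε) :
    ∃ D₀ : ℕ, ∀ D ≥ D₀, ∀ (V α ι : Type) [Fintype V] [Fintype α] [Fintype ι]
      [Nonempty α] (S : ι → Finset V) (L : V → Finset α) (M : V × α → V × α → Prop)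
      (w : V × α → ℝ) (U : Finset V) (ρ : ℝ), IsSystem S L M K Λ D →
      IsWeighting S M w U ρ (1 / D) → 0 ≤ ρ → ρ ≤ 1 - ε → IsColorable M w U := by
  have hK' : (1 : ℝ) ≤ K := by exact_mod_cast hK
  set ρ₀ : ℝ := 1 / (16 * K) with hρ₀
  have hρ₀' : 0 < ρ₀ := by positivity
  set p : ℝ := min (1 / (16 * K)) (ρ₀ * ε / (50 * K ^ 2)) with hp
  have hp0 : 0 < p := lt_min (by positivity) (by positivity)
  have hpK : p * K ≤ 1 / 16 := by
    have : p * K ≤ 1 / (16 * K) * K := by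
      gcongr
      exact min_le_left _ _
    refine this.trans (le_of_eq ?_)
    field_simp
  have hpε : 25 * (K * p) ^ 2 ≤ p * (ρ₀ * ε) / 2 := by
    have h1 : p * (50 * K ^ 2) ≤ ρ₀ * ε := (le_div_iff₀ (by positivity)).1 (min_le_right _ _)
    nlinarith
  have hη : 0 < p * (ρ₀ * ε) / 2 := by positivity
  obtain ⟨n, hn⟩ := exists_nat_ge (1 / (p * (ρ₀ * ε) / 2))
  rw [div_le_iff₀ hη] at hn
  obtain ⟨D₀, hD₀⟩ := IsSystem.isColorable_iteration (Λ := Λ) hK hp0 hpK hε hρ₀'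
    (by rw [hρ₀]; field_simp; rfl) hpε n 1 le_rfl
  exact ⟨D₀, fun D hD V α ι _ _ _ _ S L M w U ρ hS hw h0 h1 =>
    hD₀ D hD V α ι S L M w U ρ hS hw h0 h1 (by linarith)⟩

end Iteration

section Uniform

open scoped Classical

lemma exists_coloring_of_card_eq {K Λ : ℕ} (hK : 1 ≤ K) {ε : ℝ} (hε : 0 < ε) :
    ∃ D₀ : ℕ, ∀ D ≥ D₀, ∀ (V α ι : Type) [Fintype V] [Fintype α] [Fintype ι]
      [Nonempty α] (S : ι → Finset V) (L : V → Finset α) (M : V × α → V × α → Prop) (X : Finset V)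
      (l : ℕ), IsSystem S L M K Λ D → 0 < D → (∀ i, S i ⊆ X) → (∀ v ∈ X, (L v).card = l) →
      (1 + ε) * D ≤ l →
      ∃ φ : V → α, (∀ v ∈ X, φ v ∈ L v) ∧ ∀ u ∈ X, ∀ v ∈ X, ¬ M (u, φ u) (v, φ v) := by
  obtain ⟨D₀, h⟩ := exists_isColorable (Λ := Λ) hK (ε := ε / (1 + ε)) (by positivity)
  refine ⟨D₀, fun D hD V α ι _ _ _ _ S L M X l hS hD0 hX hl hDl => ?_⟩
  have hD0' : (0 : ℝ) < D := by exact_mod_cast hD0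
  have hl0 : (0 : ℝ) < l := lt_of_lt_of_le (by positivity) hDl
  have hDl' : (D : ℝ) ≤ l := le_trans (by nlinarith) hDl
  set w : V × α → ℝ := fun q => if q.1 ∈ X ∧ q.2 ∈ L q.1 then 1 / (l : ℝ) else 0 with hw
  have hle : ∀ q, w q ≤ 1 / l := fun q => by
    simp only [hw]
    split_ifs
    exacts [le_rfl, by positivity]
  obtain ⟨φ, hφ, hM⟩ := h D hD V α ι S L M w X (D / l) hS
    { nonneg := fun q => by
        simp only [hw]
        split_ifs <;> positivity
      le := fun q => (hle q).trans (by gcongr)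
      sum_eq := fun v hv => by
        simp only [hw, hv, true_and]
        rw [← sum_filter, sum_const, nsmul_eq_mul, filter_mem_eq_inter, univ_inter, hl v hv]
        field_simp
      eq_zero := fun v hv c => by simp [hw, hv]
      degree_le := fun i v hv c => by
        refine (sum_le_sum fun r _ => hle r).trans ?_
        rw [sum_const, nsmul_eq_mul, mul_one_div]
        gcongr
        exact hS.degree_le i v hv c } (by positivity) (by
        rw [div_le_iff₀ hl0]
        have : 1 - ε / (1 + ε) = 1 / (1 + ε) := by field_simp; ring
        rw [this, div_mul_eq_mul_div, le_div_iff₀ (by positivity)]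
        linarith)
  refine ⟨φ, fun v hv => ?_, hM⟩
  by_contra hc
  exact hφ v hv (by simp [hw, hc])

end Uniform

end NearlyDisjoint

/-- **Main correspondence-coloring theorem.**
A correspondence assignment is modelled by a list assignment `L` together with a symmetric
relation `M` on pairs `(vertex, color)` supported on edges of `G = ⋃ᵢ Gᵢ`, which is a
matching on each edge (each pair `(v, c)` is matched with at most one color at each
neighbor).  If the `Gᵢ` are nearly disjoint, every vertex lies in at most `C` of them,
all color degrees `Δ(Gᵢ, (L|_{V(Gᵢ)}, M|_{E(Gᵢ)})) ≤ D`, and `|L(v)| ≥ (1 + ε)D`, then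
`G` is `(L, M)`-colorable, provided `D` is sufficiently large. -/
theorem main_correspondence_coloring (C ε : ℝ) (hC : 0 < C) (hε : 0 < ε) :
    ∃ D₀ : ℕ, ∀ D : ℕ, D₀ ≤ D →
      ∀ (V : Type) [Fintype V] [DecidableEq V] (m : ℕ) (G : Fin m → SimpleGraph V)
        [∀ i, DecidableRel (G i).Adj] (S : Fin m → Finset V) (L : V → Finset ℕ)
        (M : V × ℕ → V × ℕ → Prop) [DecidableRel M],
        (∀ i u v, (G i).Adj u v → u ∈ S i ∧ v ∈ S i) →
        (∀ i j, i ≠ j → (S i ∩ S j).card ≤ 1) →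
        (∀ v ∈ (univ : Finset (Fin m)).biUnion S,
          ((univ.filter fun i => v ∈ S i).card : ℝ) ≤ C) →
        -- `M` is supported on edges of `G` with colors from the lists
        (∀ q r, M q r → (⨆ i, G i).Adj q.1 r.1 ∧ q.2 ∈ L q.1 ∧ r.2 ∈ L r.1) →
        -- `M` is symmetric
        (∀ q r, M q r → M r q) →
        -- `M(e)` is a matching for every edge `e`
        (∀ q r r', M q r → M q r' → r.1 = r'.1 → r.2 = r'.2) →
        -- color degree at most `D` within each `Gᵢ`
        (∀ i, ∀ v ∈ S i, ∀ c ∈ L v,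
          (((G i).neighborFinset v).filter fun u => ∃ c' ∈ L u, M (v, c) (u, c')).card ≤ D) →
        (∀ v ∈ (univ : Finset (Fin m)).biUnion S, (1 + ε) * D ≤ ((L v).card : ℝ)) →
        ∃ φ : V → ℕ, (∀ v ∈ (univ : Finset (Fin m)).biUnion S, φ v ∈ L v) ∧
          ∀ u v, (⨆ i, G i).Adj u v → ¬ M (u, φ u) (v, φ v) := by
  set K : ℕ := max 1 ⌊C⌋₊ with hK
  set Λ : ℕ := ⌈1 + ε⌉₊ with hΛ
  obtain ⟨D₀, hD₀⟩ := NearlyDisjoint.exists_coloring_of_card_eq (K := K) (Λ := Λ)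
    (le_max_left _ _) hε
  refine ⟨max 1 D₀, fun D hD V _ _ m G _ S L M _ hG hdisj hC' hM hsymm hmatch hdeg hL => ?_⟩
  have hD1 : 0 < D := le_trans (le_max_left _ _) hD
  set X : Finset V := univ.biUnion S with hX
  set l : ℕ := ⌈(1 + ε) * D⌉₊ with hl
  have hlist : ∀ v, ∃ t ⊆ L v, (v ∈ X → t.card = l) ∧ t.card ≤ l := by
    intro v
    by_cases hv : v ∈ X
    · obtain ⟨t, ht, htl⟩ := exists_subset_card_eq (Nat.ceil_le.2 (hL v hv))
      exact ⟨t, ht, fun _ => htl, htl.le⟩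
    · exact ⟨∅, empty_subset _, fun h => absurd h hv, by simp⟩
  choose T hTL hTX hTl using hlist
  set N : ℕ := univ.sup fun v => (T v).sup id with hN
  have hTN : ∀ v, ∀ c ∈ T v, c < N + 1 := fun v c hc => Nat.lt_succ_of_le <|
    le_trans (le_sup (f := id) hc) (le_sup (f := fun v => (T v).sup id) (mem_univ v))
  set L' : V → Finset (Fin (N + 1)) := fun v => univ.filter fun c => (c : ℕ) ∈ T v with hL'
  have hcard : ∀ v, (L' v).card = (T v).card := by
    intro v
    rw [← card_image_of_injective _ Fin.val_injective]
    congr 1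
    ext c
    simp only [hL', mem_image, mem_filter, mem_univ, true_and]
    exact ⟨by rintro ⟨a, ha, rfl⟩; exact ha, fun hc => ⟨⟨c, hTN v c hc⟩, hc, rfl⟩⟩
  have hMG : ∀ {q r}, M q r → ∃ i, (G i).Adj q.1 r.1 := fun h =>
    SimpleGraph.iSup_adj.1 (hM _ _ h).1
  have hSX : ∀ i, S i ⊆ X := fun i => subset_biUnion_of_mem S (mem_univ i)
  obtain ⟨φ, hφ, hφM⟩ := hD₀ D (le_trans (le_max_right _ _) hD) V (Fin (N + 1)) (Fin m) S L'
    (fun q r => M (q.1, q.2) (r.1, r.2) ∧ q.2 ∈ L' q.1 ∧ r.2 ∈ L' r.1) X l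
    { symm := fun h => ⟨hsymm _ _ h.1, h.2.2, h.2.1⟩
      matching := fun h h' he => Prod.ext he (Fin.ext (hmatch _ _ _ h.1 h'.1 he))
      irrefl := fun h => by
        obtain ⟨i, hi⟩ := hMG h.1
        exact hi.ne
      exists_common := fun h => by
        obtain ⟨i, hi⟩ := hMG h.1
        exact ⟨i, hG _ _ _ hi⟩
      nearlyDisjoint := fun {i j} hij => by convert hdisj i j hij
      card_le := fun v => by
        by_cases hv : v ∈ X
        · refine le_trans ?_ (le_max_right _ _)
          refine (card_le_card fun i hi => ?_).trans (Nat.le_floor (hC' v hv))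
          simpa using hi
        · exact (card_eq_zero.2 (eq_empty_of_forall_notMem fun i hi =>
            hv (hSX i (by simpa using hi)))).le.trans (Nat.zero_le _)
      mem_list := fun h => h.2.1
      card_list := fun v => by
        rw [hcard]
        refine (hTl v).trans (Nat.ceil_le.2 ?_)
        push_cast
        gcongr
        exact Nat.le_ceil _
      degree_le := fun i v hv c => by
        by_cases hc : (c : ℕ) ∈ L v
        · refine le_trans (card_le_card_of_injOn Prod.fst (fun r hr => ?_)
            fun r hr r' hr' he => ?_) (hdeg i v hv c hc)
          · simp only [coe_filter, mem_univ, true_and, Set.mem_ofPred_eq] at hr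
            obtain ⟨hri, hMr, -⟩ := hr
            obtain ⟨j, hj⟩ := hMG hMr
            have hij : i = j := by
              by_contra hij
              refine hj.ne (card_le_one.1 (hdisj i j hij) _ ?_ _ ?_)
              · exact mem_inter.2 ⟨hv, (hG _ _ _ hj).1⟩
              · exact mem_inter.2 ⟨hri, (hG _ _ _ hj).2⟩
            subst hij
            simp only [coe_filter, SimpleGraph.mem_neighborFinset, Set.mem_ofPred_eq]
            exact ⟨hj, r.2, (hM _ _ hMr).2.2, hMr⟩
          · simp only [coe_filter, mem_univ, true_and, Set.mem_ofPred_eq] at hr hr'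
            exact Prod.ext he (Fin.ext (hmatch _ _ _ hr.2.1 hr'.2.1 he))
        · exact (card_eq_zero.2 (eq_empty_of_forall_notMem fun r hr =>
            hc (hM _ _ (show M (v, c) (r.1, r.2) by
              simp only [mem_filter] at hr
              exact hr.2.2.1)).2.1)).le.trans (Nat.zero_le _) }
    hD1 hSX (fun v hv => by rw [hcard, hTX v hv]) (Nat.le_ceil _)
  refine ⟨fun v => φ v, fun v hv => hTL v (mem_filter.1 (hφ v hv)).2, fun u v huv hMuv => ?_⟩
  obtain ⟨i, hi⟩ := SimpleGraph.iSup_adj.1 huv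
  have hu := hSX i (hG _ _ _ hi).1
  have hv := hSX i (hG _ _ _ hi).2
  exact hφM u hu v hv ⟨hMuv, hφ u hu, hφ v hv⟩
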